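/- Let τ be in the complex upper half-plane, set q = e^{2πiτ}, and let u ∈ ℂ with u ∉ ℤτ+ℤ, z = e^{2πiu}. Then z ((q;q)_∞² / (−q;q)_∞) C*(z;q)³ (−z;q)_∞ (−z^{−1}q;q)_∞ = ( 2(1+z)δ_q + z/2 + zδ_z + (1/2)(1+z)δ_z² ) N*(1,0,z;q), where δ_q := (2πi)^{−1}∂/∂τ and δ_z := (2πi)^{−1}∂/∂u act on (u,τ) ↦ N*(1,0,e^{2πiu}; e^{2πiτ}). -/

import Mathlib

open Complex Real Filter

noncomputable section

/-- The Jacobi theta function ϑ(u;τ) = Σ_{ν∈ℤ+1/2} e^{πiν²τ + 2πiν(u+1/2)}. -/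
def jTheta (u τ : ℂ) : ℂ :=
  ∑' n : ℤ, Complex.exp (π * I * ((n : ℂ) + 1/2)^2 * τ + 2 * π * I * ((n : ℂ) + 1/2) * (u + 1/2))

/-- ϑ₀(u;τ) = Σ_{n∈ℤ} e^{πin²τ + 2πinu}. -/
def jTheta0 (u τ : ℂ) : ℂ :=
  ∑' n : ℤ, Complex.exp (π * I * (n : ℂ)^2 * τ + 2 * π * I * (n : ℂ) * u)

/-- ϑ₁(u;τ) = Σ_{n∈1/2+ℤ} e^{πin²τ + 2πinu}. -/
def jTheta1 (u τ : ℂ) : ℂ :=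
  ∑' n : ℤ, Complex.exp (π * I * ((n : ℂ) + 1/2)^2 * τ + 2 * π * I * ((n : ℂ) + 1/2) * u)

/-- The Dedekind eta function. -/
def dedekindEta (τ : ℂ) : ℂ :=
  Complex.exp (π * I * τ / 12) * ∏' n : ℕ, (1 - Complex.exp (2 * π * I * ((n : ℂ) + 1) * τ))

/-- The Lerch sum μ(u,v;τ). -/
def lerchMu (u v τ : ℂ) : ℂ :=
  Complex.exp (π * I * u) / jTheta v τ *
    ∑' n : ℤ, (-1 : ℂ) ^ n * Complex.exp (π * I * ((n : ℂ)^2 + (n : ℂ)) * τ + 2 * π * I * v * (n : ℂ)) /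
      (1 - Complex.exp (2 * π * I * (n : ℂ) * τ + 2 * π * I * u))

/-- a₀^{α,β}(τ). -/
def aCoef0 (α β : ℝ) (τ : ℂ) : ℂ :=
  ∑' n : ℤ, ((n : ℂ) + (α : ℂ)/2) *
    Complex.exp (2 * π * I * (n : ℂ)^2 * τ + 2 * π * I * (n : ℂ) * ((α : ℂ) * τ + (β : ℂ)))

/-- a₁^{α,β}(τ). -/
def aCoef1 (α β : ℝ) (τ : ℂ) : ℂ :=
  ∑' n : ℤ, (((n : ℂ) + 1/2) + (α : ℂ)/2) *
    Complex.exp (2 * π * I * ((n : ℂ) + 1/2)^2 * τ + 2 * π * I * ((n : ℂ) + 1/2) * ((α : ℂ) * τ + (β : ℂ)))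

/-- Finite q-Pochhammer symbol (a;q)_n. -/
def qPochN (a q : ℂ) (n : ℕ) : ℂ := ∏ j ∈ Finset.range n, (1 - a * q ^ j)

/-- Infinite q-Pochhammer symbol (a;q)_∞. -/
def qPochInf (a q : ℂ) : ℂ := ∏' j : ℕ, (1 - a * q ^ j)

/-- The modified rank generating function R*(z;q). -/
def rankStar (z q : ℂ) : ℂ :=
  (qPochInf q q)⁻¹ * ∑' n : ℤ, (-1 : ℂ) ^ n * q ^ (n * (3 * n + 1) / 2) / (1 - z * q ^ n)

/-- The modified crank generating function C*(z;q). -/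
def crankStar (z q : ℂ) : ℂ :=
  (1 - z)⁻¹ * ∏' n : ℕ, ((1 - q ^ (n + 1)) / ((1 - z * q ^ (n + 1)) * (1 - z⁻¹ * q ^ (n + 1))))

/-- N(1,0,z;q), the overpartition-rank generating function. -/
def nGen10 (z q : ℂ) : ℂ :=
  ∑' n : ℕ, qPochN (-1) q n * q ^ (n * (n + 1) / 2) / (qPochN (z * q) q n * qPochN (z⁻¹ * q) q n)

/-- N*(1,0,z;q). -/
def nStar10 (z q : ℂ) : ℂ := nGen10 z q / (1 - z)

/-- N(1,1/q,z;q²), the M2-rank generating function for overpartitions. -/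
def nGenM2over (z q : ℂ) : ℂ :=
  ∑' n : ℕ, qPochN (-1) (q^2) n * qPochN (-q) (q^2) n * q ^ n /
    (qPochN (z * q^2) (q^2) n * qPochN (z⁻¹ * q^2) (q^2) n)

/-- N*(1,1/q,z;q²). -/
def nStarM2over (z q : ℂ) : ℂ := nGenM2over z q / (1 - z)

/-- N(0,1/q,z;q²), the M2-rank generating function for partitions without repeated odd parts. -/
def nGenM2 (z q : ℂ) : ℂ :=
  ∑' n : ℕ, qPochN (-q) (q^2) n * q ^ (n^2) /
    (qPochN (z * q^2) (q^2) n * qPochN (z⁻¹ * q^2) (q^2) n)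

/-- N*(0,1/q,z;q²). -/
def nStarM2 (z q : ℂ) : ℂ := nGenM2 z q / (1 - z)

/-- The odd-rank generating function R^o(z;q). -/
def oddRank (z q : ℂ) : ℂ :=
  (qPochInf (q^2) (q^2))⁻¹ * ∑' n : ℤ, (-1 : ℂ) ^ n * q ^ (3 * n^2 + 3 * n + 1) / (1 - z * q ^ (2 * n + 1))

/-! ### Infinite `q`-Pochhammer symbols -/

lemma summable_norm_mul_pow (a : ℂ) {q : ℂ} (hq : ‖q‖ < 1) :
    Summable fun j : ℕ => ‖-(a * q ^ j)‖ := by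
  simpa using (summable_geometric_of_lt_one (norm_nonneg q) hq).mul_left ‖a‖

lemma multipliable_qPoch (a : ℂ) {q : ℂ} (hq : ‖q‖ < 1) :
    Multipliable fun j : ℕ => 1 - a * q ^ j := by
  simpa [sub_eq_add_neg] using multipliable_one_add_of_summable (summable_norm_mul_pow a hq)

lemma tendsto_qPochN (a : ℂ) {q : ℂ} (hq : ‖q‖ < 1) :
    Tendsto (qPochN a q) atTop (nhds (qPochInf a q)) :=
  (multipliable_qPoch a hq).hasProd.tendsto_prod_nat

lemma qPochInf_ne_zero {a q : ℂ} (hq : ‖q‖ < 1) (h : ∀ j : ℕ, 1 - a * q ^ j ≠ 0) :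
    qPochInf a q ≠ 0 := by
  have := tprod_one_add_ne_zero_of_summable (f := fun j : ℕ => -(a * q ^ j))
    (by simpa [sub_eq_add_neg] using h) (summable_norm_mul_pow a hq)
  simpa [qPochInf, sub_eq_add_neg] using this

lemma qPochN_succ (a q : ℂ) (n : ℕ) : qPochN a q (n + 1) = qPochN a q n * (1 - a * q ^ n) :=
  Finset.prod_range_succ _ _

lemma qPochN_succ' (a q : ℂ) (n : ℕ) : qPochN a q (n + 1) = (1 - a) * qPochN (a * q) q n := by
  simp only [qPochN, Finset.prod_range_succ']
  rw [mul_comm, pow_zero, mul_one]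
  exact congrArg _ (Finset.prod_congr rfl fun j _ => by ring)

lemma qPochInf_eq_mul (a : ℂ) {q : ℂ} (hq : ‖q‖ < 1) :
    qPochInf a q = (1 - a) * qPochInf (a * q) q := by
  refine tendsto_nhds_unique ((tendsto_qPochN a hq).comp (tendsto_add_atTop_nat 1)) ?_
  refine ((tendsto_qPochN (a * q) hq).const_mul (1 - a)).congr fun n => ?_
  simp [qPochN_succ']

lemma one_sub_mul_pow_ne_zero {a q : ℂ} (ha : ‖a‖ < 1) (hq : ‖q‖ < 1) (j : ℕ) :
    1 - a * q ^ j ≠ 0 := by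
  intro h
  have h1 : ‖a * q ^ j‖ = 1 := by rw [← sub_eq_zero.mp h, norm_one]
  rw [norm_mul, norm_pow] at h1
  have h2 : ‖q‖ ^ j ≤ 1 := pow_le_one₀ (norm_nonneg _) hq.le
  nlinarith [norm_nonneg a]

lemma qPochInf_ne_zero_of_norm_lt {a q : ℂ} (ha : ‖a‖ < 1) (hq : ‖q‖ < 1) :
    qPochInf a q ≠ 0 :=
  qPochInf_ne_zero hq (one_sub_mul_pow_ne_zero ha hq)

lemma qPochN_ne_zero_of_norm_lt {a q : ℂ} (ha : ‖a‖ < 1) (hq : ‖q‖ < 1) (n : ℕ) :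
    qPochN a q n ≠ 0 :=
  Finset.prod_ne_zero_iff.mpr fun j _ => one_sub_mul_pow_ne_zero ha hq j

lemma differentiable_qPochInf {q : ℂ} (hq : ‖q‖ < 1) :
    Differentiable ℂ fun a => qPochInf a q := by
  have key : ∀ R : ℝ, DifferentiableOn ℂ (fun a => qPochInf a q) (Metric.ball 0 R) := by
    intro R
    have hs : Summable fun j : ℕ => R * ‖q‖ ^ j :=
      (summable_geometric_of_lt_one (norm_nonneg q) hq).mul_left R
    have hp : HasProdLocallyUniformlyOn (fun (j : ℕ) (a : ℂ) => 1 + -(a * q ^ j))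
        (fun a => ∏' j : ℕ, (1 + -(a * q ^ j))) (Metric.ball 0 R) := by
      refine hs.hasProdLocallyUniformlyOn_nat_one_add Metric.isOpen_ball
        (Eventually.of_forall fun j a ha => ?_) (fun j => by fun_prop)
      rw [norm_neg, norm_mul, norm_pow]
      have : ‖a‖ < R := by simpa using ha
      gcongr
    have := hp.differentiableOn (.of_forall fun s => by
      simpa [Finset.prod_fn] using DifferentiableOn.finsetProd (fun _ _ => by fun_prop))
      Metric.isOpen_ball
    simpa [qPochInf, sub_eq_add_neg] using this
  intro a
  exact (key (‖a‖ + 1)).differentiableAt (Metric.isOpen_ball.mem_nhds (by simp))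

/-- The reciprocal `1/(q;q)_m`, extended by zero to negative `m`. -/
def invQFact (q : ℂ) (m : ℤ) : ℂ := if 0 ≤ m then (qPochN q q m.toNat)⁻¹ else 0

lemma invQFact_of_neg (q : ℂ) {m : ℤ} (hm : m < 0) : invQFact q m = 0 := by
  simp [invQFact, not_le.mpr hm]

lemma invQFact_natCast (q : ℂ) (m : ℕ) : invQFact q m = (qPochN q q m)⁻¹ := by
  simp [invQFact]

lemma invQFact_zero (q : ℂ) : invQFact q 0 = 1 := by simp [invQFact, qPochN]

lemma one_sub_zpow_mul_invQFact {q : ℂ} (hq : ‖q‖ < 1) (m : ℤ) :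
    (1 - q ^ m) * invQFact q m = invQFact q (m - 1) := by
  rcases lt_trichotomy m 0 with h | rfl | h
  · rw [invQFact_of_neg q h, invQFact_of_neg q (by lia), mul_zero]
  · rw [invQFact_of_neg q (by lia : (0 : ℤ) - 1 < 0)]; simp
  · obtain ⟨n, rfl⟩ : ∃ n : ℕ, m = n + 1 := ⟨(m - 1).toNat, by lia⟩
    have h1 := one_sub_mul_pow_ne_zero hq hq n
    have h2 := qPochN_ne_zero_of_norm_lt hq hq n
    rw [add_sub_cancel_right, show (n : ℤ) + 1 = ((n + 1 : ℕ) : ℤ) by push_cast; ring,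
      invQFact_natCast, invQFact_natCast, qPochN_succ, zpow_natCast, pow_succ']
    field_simp

lemma exists_norm_invQFact_le {q : ℂ} (hq : ‖q‖ < 1) :
    ∃ C : ℝ, 0 ≤ C ∧ ∀ m : ℤ, ‖invQFact q m‖ ≤ C := by
  have h := ((tendsto_qPochN q hq).inv₀ (qPochInf_ne_zero_of_norm_lt hq hq)).norm
  obtain ⟨C, hC⟩ := h.bddAbove_range
  have hC' : ∀ n : ℕ, ‖(qPochN q q n)⁻¹‖ ≤ C := fun n => hC ⟨n, rfl⟩
  have hC0 : 0 ≤ C := (norm_nonneg _).trans (hC' 0)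
  refine ⟨C, hC0, fun m => ?_⟩
  unfold invQFact
  split_ifs
  · exact hC' _
  · simpa using hC0

lemma exists_norm_qPochN_le (a : ℂ) {q : ℂ} (hq : ‖q‖ < 1) :
    ∃ C : ℝ, 0 ≤ C ∧ ∀ n : ℕ, ‖qPochN a q n‖ ≤ C := by
  obtain ⟨C, hC⟩ := (tendsto_qPochN a hq).norm.bddAbove_range
  have hC' : ∀ n : ℕ, ‖qPochN a q n‖ ≤ C := fun n => hC ⟨n, rfl⟩
  exact ⟨C, (norm_nonneg _).trans (hC' 0), hC'⟩

/-! ### A finite partial fraction expansion -/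

/-- The power `q^{r(r-1)/2}`. -/
def triPow (q : ℂ) (r : ℤ) : ℂ := q ^ (r * (r - 1) / 2)

lemma triPow_zero (q : ℂ) : triPow q 0 = 1 := by simp [triPow]

lemma triPow_add_one {q : ℂ} (hq : q ≠ 0) (r : ℤ) : triPow q (r + 1) = triPow q r * q ^ r := by
  rw [triPow, triPow, ← zpow_add₀ hq]
  congr 1
  rw [show (r + 1) * (r + 1 - 1) = r * (r - 1) + r * 2 by ring]
  exact Int.add_mul_ediv_right _ _ (by norm_num)

lemma triPow_mul_zpow {q : ℂ} (hq : q ≠ 0) (r : ℤ) : triPow q r * q ^ r = triPow q (-r) := by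
  rw [← triPow_add_one hq, triPow, triPow]
  congr 2
  ring

lemma triPow_sq {q : ℂ} (hq : q ≠ 0) (r : ℤ) : triPow q r ^ 2 * q ^ r = q ^ (r ^ 2) := by
  rw [triPow, ← zpow_natCast, ← zpow_mul, ← zpow_add₀ hq]
  congr 1
  have : 2 ∣ r * (r - 1) := (Int.even_mul_pred_self r).two_dvd
  push_cast
  rw [Int.ediv_mul_cancel this]
  ring

lemma norm_triPow_le_one {q : ℂ} (hq1 : ‖q‖ < 1) (r : ℤ) : ‖triPow q r‖ ≤ 1 := by
  obtain ⟨n, hn⟩ : ∃ n : ℕ, r * (r - 1) / 2 = n :=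
    Int.eq_ofNat_of_zero_le (Int.ediv_nonneg (by
      rcases le_or_gt r 0 with h | h <;> nlinarith) (by norm_num))
  rw [triPow, hn, zpow_natCast, norm_pow]
  exact pow_le_one₀ (norm_nonneg q) hq1.le

/-- The summand `(-1)^r q^{r(r-1)/2 + sr} / ((q;q)_{M-r} (q;q)_{L+r})`. -/
def binomTerm (q : ℂ) (M L s r : ℤ) : ℂ :=
  (-1) ^ r * triPow q r * q ^ (s * r) * invQFact q (M - r) * invQFact q (L + r)

lemma summable_mul_invQFact_mul (q : ℂ) (M L : ℤ) (w : ℤ → ℂ) :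
    Summable fun r => w r * invQFact q (M - r) * invQFact q (L + r) := by
  refine summable_of_ne_finset_zero (s := Finset.Icc (-L) M) fun r hr => ?_
  rw [Finset.mem_Icc, not_and_or, not_le, not_le] at hr
  rcases hr with h | h
  · rw [invQFact_of_neg q (by lia : L + r < 0), mul_zero]
  · rw [invQFact_of_neg q (by lia : M - r < 0), mul_zero, zero_mul]

lemma summable_binomTerm (q : ℂ) (M L s : ℤ) : Summable (binomTerm q M L s) :=
  summable_mul_invQFact_mul q M L _

lemma binomTerm_add_one {q : ℂ} (hq : q ≠ 0) (M L s r : ℤ) :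
    binomTerm q M L s (r + 1) = -q ^ s * binomTerm q (M - 1) (L + 1) (s + 1) r := by
  unfold binomTerm
  rw [triPow_add_one hq, zpow_add_one₀ (by norm_num), show s * (r + 1) = s * r + s by ring,
    zpow_add₀ hq (s * r) s, show (s + 1) * r = s * r + r by ring, zpow_add₀ hq (s * r) r,
    show M - (r + 1) = M - 1 - r by ring, show L + (r + 1) = L + 1 + r by ring]
  ring

lemma binomTerm_sub_left {q : ℂ} (hq : q ≠ 0) (hq1 : ‖q‖ < 1) (M L s r : ℤ) :
    binomTerm q M L s r - q ^ L * binomTerm q M L (s + 1) r = binomTerm q M (L - 1) s r := by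
  unfold binomTerm
  rw [show (s + 1) * r = s * r + r by ring, zpow_add₀ hq (s * r) r,
    show L - 1 + r = L + r - 1 by ring, ← one_sub_zpow_mul_invQFact hq1 (L + r), zpow_add₀ hq L r]
  ring

lemma binomTerm_sub_right {q : ℂ} (hq : q ≠ 0) (hq1 : ‖q‖ < 1) (M L s r : ℤ) :
    binomTerm q M L (s + 1) r - q ^ M * binomTerm q M L s r = binomTerm q (M - 1) L (s + 1) r := by
  unfold binomTerm
  rw [show (s + 1) * r = s * r + r by ring, zpow_add₀ hq (s * r) r,
    show M - 1 - r = M - r - 1 by ring, ← one_sub_zpow_mul_invQFact hq1 (M - r), zpow_sub₀ hq M r]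
  have := zpow_ne_zero r hq
  field_simp

lemma tsum_binomTerm_recurrence {q : ℂ} (hq : q ≠ 0) (hq1 : ‖q‖ < 1) (M L s : ℤ) :
    (1 - q ^ (L + M)) * ∑' r, binomTerm q M L s r
      = (1 - q ^ (L - s)) * ∑' r, binomTerm q M (L - 1) s r := by
  have hX := summable_binomTerm q M L s
  have hY := summable_binomTerm q M L (s + 1)
  have e1 : ∑' r, binomTerm q M L s r - q ^ L * ∑' r, binomTerm q M L (s + 1) r
      = ∑' r, binomTerm q M (L - 1) s r := by
    rw [← tsum_mul_left, ← hX.tsum_sub (hY.mul_left _)]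
    exact tsum_congr fun r => binomTerm_sub_left hq hq1 M L s r
  have e2 : ∑' r, binomTerm q M L (s + 1) r - q ^ M * ∑' r, binomTerm q M L s r
      = ∑' r, binomTerm q (M - 1) L (s + 1) r := by
    rw [← tsum_mul_left, ← hY.tsum_sub (hX.mul_left _)]
    exact tsum_congr fun r => binomTerm_sub_right hq hq1 M L s r
  have e3 : ∑' r, binomTerm q M (L - 1) s r = -q ^ s * ∑' r, binomTerm q (M - 1) L (s + 1) r := by
    rw [← (Equiv.addRight (1 : ℤ)).tsum_eq, ← tsum_mul_left]
    refine tsum_congr fun r => ?_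
    rw [Equiv.coe_addRight, binomTerm_add_one hq, sub_add_cancel]
  have hs := zpow_ne_zero s hq
  rw [zpow_add₀ hq, zpow_sub₀ hq]
  field_simp
  linear_combination q ^ s * e1 + q ^ L * q ^ s * e2 + q ^ L * e3

lemma zpow_ne_one_of_norm_lt_one {q : ℂ} (hq1 : ‖q‖ < 1) {n : ℤ} (hn : 0 < n) : q ^ n ≠ 1 := by
  lift n to ℕ using hn.le
  intro h
  have := congrArg norm h
  rw [zpow_natCast, norm_pow, norm_one] at this
  exact (pow_lt_one₀ (norm_nonneg q) hq1 (by lia)).ne this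

lemma tsum_binomTerm_eq_zero {q : ℂ} (hq : q ≠ 0) (hq1 : ‖q‖ < 1) (M s : ℤ) (h : 0 < s + M)
    (k : ℕ) : ∑' r, binomTerm q M (s + k) s r = 0 := by
  have hne : (1 : ℂ) - q ^ (s + k + M) ≠ 0 :=
    sub_ne_zero.mpr (zpow_ne_one_of_norm_lt_one hq1 (by lia)).symm
  refine (mul_eq_zero.mp ?_).resolve_left hne
  rw [tsum_binomTerm_recurrence hq hq1]
  cases k with
  | zero => simp
  | succ k =>
    rw [show s + ((k + 1 : ℕ) : ℤ) - 1 = s + k by push_cast; ring,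
      tsum_binomTerm_eq_zero hq hq1 M s h k, mul_zero]

lemma partial_fraction {q z : ℂ} (hq : q ≠ 0) (hq1 : ‖q‖ < 1) (hz : z ≠ 0)
    (hzq : ∀ n : ℤ, 1 - z * q ^ n ≠ 0) (n : ℕ) :
    ∑' r : ℤ, (-1) ^ r * triPow q r * q ^ r / (1 - z * q ^ r) * invQFact q (n - r)
        * invQFact q (n + r) = ((1 - z) * (qPochN (z * q) q n * qPochN (z⁻¹ * q) q n))⁻¹ := by
  induction n with
  | zero =>
    rw [tsum_eq_single 0]
    · simp [invQFact_zero, triPow_zero, qPochN]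
    · intro r hr
      rcases lt_or_gt_of_ne hr with h | h
      · rw [invQFact_of_neg q (by lia : ((0 : ℕ) : ℤ) + r < 0), mul_zero]
      · rw [invQFact_of_neg q (by lia : ((0 : ℕ) : ℤ) - r < 0), mul_zero, zero_mul]
  | succ n ih =>
    set N : ℤ := ((n + 1 : ℕ) : ℤ) with hN
    have h1 : ∑' r, binomTerm q N N 1 r = 0 := by
      simpa [hN, add_comm] using tsum_binomTerm_eq_zero hq hq1 N 1 (by lia) n
    have h0 : ∑' r, binomTerm q N N 0 r = 0 := by
      simpa [hN] using tsum_binomTerm_eq_zero hq hq1 N 0 (by lia) (n + 1)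
    have key : (1 - z * q ^ N) * (1 - z⁻¹ * q ^ N) * ∑' r : ℤ, (-1) ^ r * triPow q r * q ^ r /
        (1 - z * q ^ r) * invQFact q (N - r) * invQFact q (N + r)
        = ∑' r : ℤ, (-1) ^ r * triPow q r * q ^ r / (1 - z * q ^ r) * invQFact q (n - r)
        * invQFact q (n + r) := by
      have e : ∀ r : ℤ, (-1) ^ r * triPow q r * q ^ r / (1 - z * q ^ r) * invQFact q (n - r)
          * invQFact q (n + r) = (1 - z * q ^ N) * (1 - z⁻¹ * q ^ N) * ((-1) ^ r * triPow q r *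
          q ^ r / (1 - z * q ^ r) * invQFact q (N - r) * invQFact q (N + r))
          - q ^ N * binomTerm q N N 0 r + q ^ N * z⁻¹ * binomTerm q N N 1 r := by
        intro r
        unfold binomTerm
        rw [show (n : ℤ) - r = N - r - 1 by lia, show (n : ℤ) + r = N + r - 1 by lia,
          ← one_sub_zpow_mul_invQFact hq1 (N - r), ← one_sub_zpow_mul_invQFact hq1 (N + r),
          zero_mul, one_mul, zpow_zero, zpow_sub₀ hq, zpow_add₀ hq]
        have hQ := zpow_ne_zero r hq
        have hx := hzq r
        generalize q ^ r = Q at hQ hx ⊢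
        generalize q ^ N = P
        have hd : (1 - z * Q)⁻¹ * (1 - z * Q) = 1 := inv_mul_cancel₀ hx
        rw [div_eq_mul_inv]
        generalize (1 - z * Q)⁻¹ = d at hd ⊢
        field_simp
        linear_combination
          (Q * P - z * P) * triPow q r * invQFact q (N - r) * invQFact q (N + r) * hd
      rw [tsum_congr e]
      have s := (summable_mul_invQFact_mul q N N
        (fun r => (-1) ^ r * triPow q r * q ^ r / (1 - z * q ^ r))).mul_left
        ((1 - z * q ^ N) * (1 - z⁻¹ * q ^ N))
      rw [(s.sub ((summable_binomTerm q N N 0).mul_left _)).tsum_add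
        ((summable_binomTerm q N N 1).mul_left _), s.tsum_sub
        ((summable_binomTerm q N N 0).mul_left _), tsum_mul_left, tsum_mul_left, tsum_mul_left,
        h0, h1]
      ring
    rw [ih] at key
    have hA : 1 - z * q ^ N ≠ 0 := hzq N
    have hB : 1 - z⁻¹ * q ^ N ≠ 0 := by
      intro h
      apply hzq (-N)
      have := zpow_ne_zero N hq
      rw [zpow_neg]
      field_simp at h ⊢
      linear_combination -h
    rw [qPochN_succ, qPochN_succ]
    have e : ∀ w : ℂ, w * q * q ^ n = w * q ^ N := fun w => by
      rw [hN, zpow_natCast]; ring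
    rw [e, e]
    refine eq_inv_of_mul_eq_one_left ?_
    have hne : (1 - z) * (qPochN (z * q) q n * qPochN (z⁻¹ * q) q n) ≠ 0 := by
      refine mul_ne_zero (by simpa using hzq 0) (mul_ne_zero ?_ ?_)
      · refine Finset.prod_ne_zero_iff.mpr fun j _ => ?_
        convert hzq (j + 1) using 2
        rw [zpow_add_one₀ hq, zpow_natCast]
        ring
      · refine Finset.prod_ne_zero_iff.mpr fun j _ h => hzq (-(j + 1)) ?_
        rw [zpow_neg, zpow_add_one₀ hq, zpow_natCast]
        field_simp at h ⊢
        linear_combination -h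
    have key := (congrArg (· * ((1 - z) * (qPochN (z * q) q n * qPochN (z⁻¹ * q) q n))) key).trans
      (inv_mul_cancel₀ hne)
    linear_combination key

/-! ### Summation of the Bailey-type kernel -/

/-- The numerator `(-1;q)_n q^{n(n+1)/2}` of the overpartition rank series. -/
def rankNum (q : ℂ) (n : ℕ) : ℂ := qPochN (-1) q n * q ^ (n * (n + 1) / 2)

lemma triangle_add (m k : ℕ) :
    (m + k) * (m + k + 1) / 2 = k * (k + 1) / 2 + (m * (m + 1) / 2 + m * k) := by
  obtain ⟨a, ha⟩ := (Nat.even_mul_succ_self k).two_dvd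
  obtain ⟨b, hb⟩ := (Nat.even_mul_succ_self m).two_dvd
  rw [show (m + k) * (m + k + 1) = k * (k + 1) + m * (m + 1) + 2 * (m * k) by ring, ha, hb]
  lia

lemma rankNum_succ (q : ℂ) (n : ℕ) :
    rankNum q (n + 1) = rankNum q n * (1 + q ^ n) * q ^ (n + 1) := by
  have := triangle_add n 1
  rw [rankNum, rankNum, qPochN_succ, this]
  norm_num [pow_add]
  ring

lemma le_triangle (n : ℕ) : n ≤ n * (n + 1) / 2 := by
  rw [Nat.le_div_iff_mul_le (by norm_num)]
  rcases n with _ | n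
  · simp
  · nlinarith

lemma exists_norm_rankNum_le {q : ℂ} (hq1 : ‖q‖ < 1) :
    ∃ C : ℝ, 0 ≤ C ∧ ∀ n : ℕ, ‖rankNum q n‖ ≤ C * ‖q‖ ^ n := by
  obtain ⟨C, hC0, hC⟩ := exists_norm_qPochN_le (-1) hq1
  refine ⟨C, hC0, fun n => ?_⟩
  rw [rankNum, norm_mul, norm_pow]
  exact mul_le_mul (hC n) (pow_le_pow_of_le_one (norm_nonneg q) hq1.le (le_triangle n))
    (by positivity) hC0

/-- The sum `∑ (-1;q)_n q^{n(n+1)/2} / ((q;q)_{n-r} (q;q)_{n+r})`. -/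
def kernelSum (q : ℂ) (r : ℤ) : ℂ :=
  ∑' n : ℕ, rankNum q n * invQFact q (n - r) * invQFact q (n + r)

lemma summable_rankNum_mul {q : ℂ} (hq1 : ‖q‖ < 1) (i j : ℤ) :
    Summable fun n : ℕ => rankNum q n * invQFact q (n + i) * invQFact q (n + j) := by
  obtain ⟨C, hC0, hC⟩ := exists_norm_rankNum_le hq1
  obtain ⟨D, hD0, hD⟩ := exists_norm_invQFact_le hq1
  refine Summable.of_norm_bounded (g := fun n => C * ‖q‖ ^ n * D * D)
    ((((summable_geometric_of_lt_one (norm_nonneg q) hq1).mul_left C).mul_right D).mul_right D)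
    fun n => ?_
  rw [norm_mul, norm_mul]
  have h1 := hC n
  have h2 := hD (n + i)
  have h3 := hD (n + j)
  gcongr

lemma kernelSum_neg (q : ℂ) (r : ℤ) : kernelSum q (-r) = kernelSum q r := by
  unfold kernelSum
  refine tsum_congr fun n => ?_
  rw [sub_neg_eq_add, ← sub_eq_add_neg]
  ring

lemma kernelSum_recurrence {q : ℂ} (hq : q ≠ 0) (hq1 : ‖q‖ < 1) {r : ℤ} (hr : 0 ≤ r) :
    (1 + q ^ (r + 1)) * kernelSum q (r + 1) = q ^ (r + 1) * (1 + q ^ r) * kernelSum q r := by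
  set U : ℕ → ℂ := fun n => rankNum q n * invQFact q (n + (-r - 1)) * invQFact q (n + r) with hU
  have hUs : Summable U := summable_rankNum_mul hq1 _ _
  have hU0 : U 0 = 0 := by
    simp only [hU]
    rw [invQFact_of_neg q (by lia : ((0 : ℕ) : ℤ) + (-r - 1) < 0), mul_zero, zero_mul]
  have htel : ∑' n, U (n + 1) = ∑' n, U n := by
    rw [hUs.tsum_eq_zero_add, hU0, zero_add]
  have hUs' : Summable fun n => U (n + 1) := (summable_nat_add_iff 1).mpr hUs
  have s1 : Summable fun n : ℕ => rankNum q n * invQFact q (n - (r + 1)) *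
      invQFact q (n + (r + 1)) := by
    simpa only [← sub_eq_add_neg] using summable_rankNum_mul hq1 (-(r + 1)) (r + 1)
  have s0 : Summable fun n : ℕ => rankNum q n * invQFact q (n - r) * invQFact q (n + r) := by
    simpa only [← sub_eq_add_neg] using summable_rankNum_mul hq1 (-r) r
  have key : ∀ n : ℕ, (1 + q ^ (r + 1)) * (rankNum q n * invQFact q (n - (r + 1)) *
      invQFact q (n + (r + 1))) = q ^ (r + 1) * (1 + q ^ r) * (rankNum q n * invQFact q (n - r) *
      invQFact q (n + r)) - (1 - q ^ (2 * r + 1)) * (U (n + 1) - U n) := by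
    intro n
    simp only [hU]
    rw [rankNum_succ, show ((n + 1 : ℕ) : ℤ) + (-r - 1) = n - r by push_cast; ring,
      show ((n + 1 : ℕ) : ℤ) + r = n + r + 1 by push_cast; ring,
      show (n : ℤ) + (-r - 1) = n - r - 1 by ring, show (n : ℤ) - (r + 1) = n - r - 1 by ring,
      show (n : ℤ) + (r + 1) = n + r + 1 by ring,
      show invQFact q (n + r) = (1 - q ^ ((n : ℤ) + r + 1)) * invQFact q (n + r + 1) by
        rw [one_sub_zpow_mul_invQFact hq1, add_sub_cancel_right],
      ← one_sub_zpow_mul_invQFact hq1 (n - r), zpow_sub₀ hq, zpow_add_one₀ hq, zpow_add_one₀ hq,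
      zpow_add₀ hq, zpow_add_one₀ hq, two_mul, zpow_add₀ hq, zpow_natCast, pow_succ]
    have hQ := zpow_ne_zero r hq
    generalize q ^ r = Q at hQ ⊢
    field_simp
    ring
  unfold kernelSum
  rw [← tsum_mul_left, ← tsum_mul_left, tsum_congr key,
    (s0.mul_left _).tsum_sub ((hUs'.sub hUs).mul_left _), tsum_mul_left (f := fun n => U (n + 1) - U n),
    hUs'.tsum_sub hUs, htel, sub_self, mul_zero, sub_zero]

/-- The kernel sum with its leading power of `q` removed. -/
def kernelTail (q : ℂ) (k : ℕ) : ℂ :=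
  ∑' m : ℕ, qPochN (-1) q (m + k) * (q ^ (m * (m + 1) / 2) * (q ^ m) ^ k) * invQFact q m *
    invQFact q (m + 2 * k : ℕ)

lemma kernelSum_natCast {q : ℂ} (hq1 : ‖q‖ < 1) (k : ℕ) :
    kernelSum q k = q ^ (k * (k + 1) / 2) * kernelTail q k := by
  have s0 : Summable fun n : ℕ => rankNum q n * invQFact q (n - k) * invQFact q (n + k) := by
    simpa only [← sub_eq_add_neg] using summable_rankNum_mul hq1 (-k) k
  rw [kernelSum, ← s0.sum_add_tsum_nat_add k, Finset.sum_eq_zero, zero_add, kernelTail,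
    ← tsum_mul_left]
  · refine tsum_congr fun m => ?_
    rw [rankNum, triangle_add, pow_add, pow_add, pow_mul,
      show ((m + k : ℕ) : ℤ) - k = m by push_cast; ring,
      show ((m + k : ℕ) : ℤ) + k = (m + 2 * k : ℕ) by push_cast; ring]
    ring
  · intro n hn
    rw [invQFact_of_neg q (by have := Finset.mem_range.mp hn; lia), mul_zero, zero_mul]

lemma tendsto_kernelTail {q : ℂ} (hq1 : ‖q‖ < 1) :
    Tendsto (kernelTail q) atTop (nhds (qPochInf (-1) q / qPochInf q q)) := by
  obtain ⟨C, hC0, hC⟩ := exists_norm_qPochN_le (-1) hq1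
  obtain ⟨D, hD0, hD⟩ := exists_norm_invQFact_le hq1
  have hlim : qPochInf (-1) q / qPochInf q q = ∑' m : ℕ, qPochInf (-1) q *
      (q ^ (m * (m + 1) / 2) * if m = 0 then 1 else 0) * invQFact q m * (qPochInf q q)⁻¹ := by
    rw [tsum_eq_single 0 (by intro m hm; simp [hm])]
    simp [invQFact_zero, div_eq_mul_inv]
  rw [hlim]
  refine tendsto_tsum_of_dominated_convergence (bound := fun m => C * (‖q‖ ^ m * 1) * D * D)
    (by simpa using (((summable_geometric_of_lt_one (norm_nonneg q) hq1).mul_left C).mul_right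
      D).mul_right D) ?_ ?_
  · intro m
    have h1 : Tendsto (fun k => qPochN (-1) q (m + k)) atTop (nhds (qPochInf (-1) q)) := by
      simp only [add_comm m]
      exact (tendsto_qPochN (-1) hq1).comp (tendsto_add_atTop_nat m)
    have h2 : Tendsto (fun k : ℕ => invQFact q (m + 2 * k : ℕ)) atTop
        (nhds (qPochInf q q)⁻¹) := by
      simp only [invQFact_natCast]
      refine ((tendsto_qPochN q hq1).comp ?_).inv₀ (qPochInf_ne_zero_of_norm_lt hq1 hq1)
      exact tendsto_atTop_mono (fun k => show k ≤ m + 2 * k by lia) tendsto_id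
    have h3 : Tendsto (fun k : ℕ => (q ^ m) ^ k) atTop (nhds (if m = 0 then 1 else 0)) := by
      split_ifs with h
      · simp [h]
      · refine tendsto_pow_atTop_nhds_zero_of_norm_lt_one ?_
        rw [norm_pow]
        exact pow_lt_one₀ (norm_nonneg q) hq1 h
    exact ((h1.mul (h3.const_mul _)).mul_const _).mul h2
  · refine Eventually.of_forall fun k m => ?_
    rw [norm_mul, norm_mul, norm_mul, norm_mul, norm_pow, norm_pow, norm_pow]
    have h1 := hC (m + k)
    have h2 := hD m
    have h3 := hD (m + 2 * k : ℕ)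
    have h4 : ‖q‖ ^ (m * (m + 1) / 2) ≤ ‖q‖ ^ m :=
      pow_le_pow_of_le_one (norm_nonneg q) hq1.le (le_triangle m)
    have h5 : (‖q‖ ^ m) ^ k ≤ 1 :=
      pow_le_one₀ (by positivity) (pow_le_one₀ (norm_nonneg q) hq1.le)
    gcongr

lemma one_add_pow_mul_kernelTail {q : ℂ} (hq : q ≠ 0) (hq1 : ‖q‖ < 1) (k : ℕ) :
    (1 + q ^ k) * kernelTail q k = qPochInf (-1) q / qPochInf q q := by
  have step : ∀ k : ℕ, (1 + q ^ (k + 1)) * kernelTail q (k + 1) = (1 + q ^ k) * kernelTail q k := by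
    intro k
    have h := kernelSum_recurrence hq hq1 (Int.natCast_nonneg k)
    rw [show (k : ℤ) + 1 = ((k + 1 : ℕ) : ℤ) by push_cast; ring, kernelSum_natCast hq1,
      kernelSum_natCast hq1, zpow_natCast, zpow_natCast,
      show (k + 1) * (k + 1 + 1) / 2 = k * (k + 1) / 2 + (k + 1) by
        rw [add_comm k 1, triangle_add 1 k, add_comm 1 k]; lia,
      pow_add q (k * (k + 1) / 2)] at h
    have h1 : q ^ (k * (k + 1) / 2) ≠ 0 := pow_ne_zero _ hq
    have h2 : q ^ (k + 1) ≠ 0 := pow_ne_zero _ hq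
    refine mul_left_cancel₀ (mul_ne_zero h1 h2) ?_
    linear_combination h
  have const : ∀ j, (1 + q ^ j) * kernelTail q j = (1 + q ^ 0) * kernelTail q 0 := by
    intro j
    induction j with
    | zero => rfl
    | succ j ih => rw [step, ih]
  have hl : Tendsto (fun j => (1 + q ^ j) * kernelTail q j) atTop
      (nhds ((1 + 0) * (qPochInf (-1) q / qPochInf q q))) :=
    (tendsto_const_nhds.add (tendsto_pow_atTop_nhds_zero_of_norm_lt_one hq1)).mul
      (tendsto_kernelTail hq1)
  simp only [const] at hl
  rw [const, tendsto_nhds_unique tendsto_const_nhds hl]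
  ring

lemma one_add_zpow_mul_kernelSum {q : ℂ} (hq : q ≠ 0) (hq1 : ‖q‖ < 1) (r : ℤ) :
    (1 + q ^ r) * kernelSum q r
      = qPochInf (-1) q / qPochInf q q * (triPow q r * q ^ r) := by
  have nat : ∀ k : ℕ, (1 + q ^ (k : ℤ)) * kernelSum q k
      = qPochInf (-1) q / qPochInf q q * (triPow q k * q ^ (k : ℤ)) := by
    intro k
    rw [kernelSum_natCast hq1, ← triPow_add_one hq, triPow, zpow_natCast,
      ← one_add_pow_mul_kernelTail hq hq1 k,
      show ((k : ℤ) + 1) * ((k : ℤ) + 1 - 1) / 2 = ((k * (k + 1) / 2 : ℕ) : ℤ) by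
        push_cast; congr 1; ring, zpow_natCast]
    ring
  obtain ⟨k, rfl | rfl⟩ := r.eq_nat_or_neg
  · exact nat k
  · have h := nat k
    rw [kernelSum_neg, ← triPow_mul_zpow hq, zpow_neg]
    have := zpow_ne_zero (k : ℤ) hq
    field_simp
    linear_combination h

lemma summable_rankNum_mul_invQFact_prod {q : ℂ} (hq1 : ‖q‖ < 1) {a : ℤ → ℂ} {A : ℝ}
    (ha : ∀ r, ‖a r‖ ≤ A) :
    Summable fun p : ℕ × ℤ =>
      rankNum q p.1 * (a p.2 * invQFact q (p.1 - p.2) * invQFact q (p.1 + p.2)) := by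
  obtain ⟨C, hC0, hC⟩ := exists_norm_rankNum_le hq1
  obtain ⟨D, hD0, hD⟩ := exists_norm_invQFact_le hq1
  have hA0 : 0 ≤ A := (norm_nonneg _).trans (ha 0)
  set σ : ℝ := √‖q‖ with hσ
  have hσ0 : 0 ≤ σ := Real.sqrt_nonneg _
  have hσ1 : σ < 1 := by rw [hσ, Real.sqrt_lt' one_pos]; simpa using hq1
  have hσq : ‖q‖ = σ ^ 2 := (Real.sq_sqrt (norm_nonneg q)).symm
  have sZ : Summable fun r : ℤ => σ ^ r.natAbs := by
    refine Summable.of_nat_of_neg ?_ ?_ <;>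
      simpa using summable_geometric_of_lt_one hσ0 hσ1
  have sP : Summable fun p : ℕ × ℤ => C * A * D * D * (σ ^ p.1 * σ ^ p.2.natAbs) :=
    ((summable_geometric_of_lt_one hσ0 hσ1).mul_of_nonneg sZ (fun _ => by positivity)
      (fun _ => by positivity)).mul_left _
  refine Summable.of_norm_bounded sP fun ⟨n, r⟩ => ?_
  dsimp only
  by_cases h : r.natAbs ≤ n
  · rw [norm_mul, norm_mul, norm_mul]
    have h1 : ‖rankNum q n‖ ≤ C * (σ ^ n * σ ^ r.natAbs) := by
      refine (hC n).trans ?_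
      rw [hσq, ← pow_mul, ← pow_add]
      exact mul_le_mul_of_nonneg_left (pow_le_pow_of_le_one hσ0 hσ1.le (by lia)) hC0
    calc _ ≤ C * (σ ^ n * σ ^ r.natAbs) * (A * D * D) := by
          have := ha r
          have := hD (n - r)
          have := hD (n + r)
          gcongr
      _ = _ := by ring
  · have : invQFact q (n - r) * invQFact q (n + r) = 0 := by
      rcases le_or_gt 0 r with hr | hr
      · rw [invQFact_of_neg q (by lia : (n : ℤ) - r < 0), zero_mul]
      · rw [invQFact_of_neg q (by lia : (n : ℤ) + r < 0), mul_zero]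
    rw [mul_assoc (a r), this]
    simp only [mul_zero, norm_zero]
    positivity

lemma tsum_rankNum_mul_tsum {q : ℂ} (hq : q ≠ 0) (hq1 : ‖q‖ < 1) {a : ℤ → ℂ} {A : ℝ}
    (ha : ∀ r, ‖a r‖ ≤ A) (hne : ∀ r : ℤ, 1 + q ^ r ≠ 0) :
    (Summable fun r : ℤ => qPochInf (-1) q / qPochInf q q *
      (a r * (triPow q r * q ^ r) / (1 + q ^ r))) ∧
    ∑' n : ℕ, rankNum q n * ∑' r : ℤ, a r * invQFact q (n - r) * invQFact q (n + r)
      = ∑' r : ℤ, qPochInf (-1) q / qPochInf q q * (a r * (triPow q r * q ^ r) / (1 + q ^ r)) := by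
  have hs := summable_rankNum_mul_invQFact_prod hq1 ha
  have inner : ∀ r : ℤ, ∑' n : ℕ, rankNum q n * (a r * invQFact q (n - r) * invQFact q (n + r))
      = qPochInf (-1) q / qPochInf q q * (a r * (triPow q r * q ^ r) / (1 + q ^ r)) := by
    intro r
    have e : kernelSum q r
        = qPochInf (-1) q / qPochInf q q * (triPow q r * q ^ r) / (1 + q ^ r) := by
      rw [eq_div_iff (hne r), ← one_add_zpow_mul_kernelSum hq hq1]
      ring
    rw [show (qPochInf (-1) q / qPochInf q q * (a r * (triPow q r * q ^ r) / (1 + q ^ r)))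
      = a r * kernelSum q r by rw [e]; ring, kernelSum, ← tsum_mul_left]
    exact tsum_congr fun n => by ring
  refine ⟨?_, ?_⟩
  · exact (summable_congr inner).mp hs.prod_symm.prod
  · have hc := Summable.tsum_comm (f := fun (n : ℕ) (r : ℤ) =>
      rankNum q n * (a r * invQFact q (n - r) * invQFact q (n + r))) hs
    rw [← tsum_congr inner, hc]
    exact tsum_congr fun n => tsum_mul_left.symm

/-! ### Uniform bounds for the summands -/

/-- The exponential `e^{2πiv}`. -/
def expTwoPi (v : ℂ) : ℂ := Complex.exp (2 * π * I * v)

lemma expTwoPi_add (v w : ℂ) : expTwoPi (v + w) = expTwoPi v * expTwoPi w := by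
  rw [expTwoPi, mul_add, Complex.exp_add]; rfl

lemma expTwoPi_ne_zero (v : ℂ) : expTwoPi v ≠ 0 := Complex.exp_ne_zero _

lemma expTwoPi_neg (v : ℂ) : expTwoPi (-v) = (expTwoPi v)⁻¹ := by
  rw [expTwoPi, mul_neg, Complex.exp_neg]; rfl

lemma expTwoPi_zero : expTwoPi 0 = 1 := by simp [expTwoPi]

lemma expTwoPi_one : expTwoPi 1 = 1 := by simp [expTwoPi, Complex.exp_two_pi_mul_I]

lemma expTwoPi_half : expTwoPi (1 / 2) = -1 := by
  rw [expTwoPi, show 2 * (π : ℂ) * I * (1 / 2) = π * I by ring, Complex.exp_pi_mul_I]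

lemma expTwoPi_int_mul (n : ℤ) (v : ℂ) : expTwoPi (n * v) = expTwoPi v ^ n := by
  rw [expTwoPi, show 2 * (π : ℂ) * I * (n * v) = n * (2 * π * I * v) by ring, Complex.exp_int_mul]
  rfl

lemma norm_expTwoPi (v : ℂ) : ‖expTwoPi v‖ = Real.exp (-(2 * π * v.im)) := by
  rw [expTwoPi, Complex.norm_exp]
  simp

lemma norm_expTwoPi_lt_one {τ : ℂ} (hτ : 0 < τ.im) : ‖expTwoPi τ‖ < 1 := by
  rw [norm_expTwoPi, Real.exp_lt_one_iff]
  have := Real.pi_pos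
  nlinarith [mul_pos this hτ]

lemma expTwoPi_eq_one_iff {v : ℂ} : expTwoPi v = 1 ↔ ∃ n : ℤ, v = n := by
  rw [expTwoPi, Complex.exp_eq_one_iff]
  have := Complex.two_pi_I_ne_zero
  refine exists_congr fun n => ⟨fun h => mul_left_cancel₀ this (by rw [h]; ring), fun h => ?_⟩
  rw [h]; ring

lemma hasDerivAt_expTwoPi (v : ℂ) : HasDerivAt expTwoPi (2 * π * I * expTwoPi v) v := by
  have := ((hasDerivAt_id v).const_mul (2 * π * I)).cexp
  exact this.congr_deriv (by simp only [expTwoPi, id]; ring)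

lemma differentiable_expTwoPi : Differentiable ℂ expTwoPi := fun v =>
  (hasDerivAt_expTwoPi v).differentiableAt

lemma continuous_expTwoPi : Continuous expTwoPi := differentiable_expTwoPi.continuous

lemma two_le_exp_two_pi : 2 ≤ Real.exp (2 * π) := by
  have h1 := Real.add_one_le_exp (2 * π)
  have h2 := Real.pi_gt_three
  linarith

lemma norm_inv_one_sub_expTwoPi_le {v : ℂ} (hv : 1 ≤ |v.im|) : ‖(1 - expTwoPi v)⁻¹‖ ≤ 2 := by
  have hπ := Real.pi_pos
  have h2 := two_le_exp_two_pi
  rw [norm_inv]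
  refine inv_le_of_inv_le₀ (by norm_num) ?_
  rcases le_abs.mp hv with h | h
  · have h3 : ‖expTwoPi v‖ ≤ 1 / 2 := by
      rw [norm_expTwoPi, Real.exp_neg, one_div]
      refine inv_anti₀ (by norm_num) (h2.trans (Real.exp_le_exp.mpr ?_))
      nlinarith
    have := norm_sub_norm_le (1 : ℂ) (expTwoPi v)
    rw [norm_one] at this
    linarith
  · have h3 : 2 ≤ ‖expTwoPi v‖ := by
      rw [norm_expTwoPi]
      refine h2.trans (Real.exp_le_exp.mpr ?_)
      nlinarith
    have := norm_sub_norm_le (expTwoPi v) 1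
    rw [norm_one, norm_sub_rev] at this
    linarith

lemma one_sub_expTwoPi_ne_zero {v : ℂ} (hv : v.im ≠ 0) : 1 - expTwoPi v ≠ 0 := by
  intro h
  obtain ⟨n, rfl⟩ := expTwoPi_eq_one_iff.mp (sub_eq_zero.mp h).symm
  simp at hv

lemma exists_eventually_norm_inv_one_sub_le (u₀ : ℂ) {τ₀ : ℂ} (hτ : 0 < τ₀.im) :
    ∃ C : ℝ, 0 ≤ C ∧ ∀ᶠ p : ℂ × ℂ in nhds (u₀, τ₀), ∀ n : ℤ, 1 - expTwoPi (u₀ + n * τ₀) ≠ 0 →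
      1 - expTwoPi (p.1 + n * p.2) ≠ 0 ∧ ‖(1 - expTwoPi (p.1 + n * p.2))⁻¹‖ ≤ C := by
  obtain ⟨N, hN⟩ := exists_nat_ge ((|u₀.im| + 2) / (τ₀.im / 2))
  rw [div_le_iff₀ (by linarith)] at hN
  set B : ℤ → ℝ := fun n => ‖(1 - expTwoPi (u₀ + n * τ₀))⁻¹‖ + 1 with hB
  have hB0 : ∀ n, 0 ≤ B n := fun n => by positivity
  refine ⟨2 + ∑ n ∈ Finset.Icc (-(N : ℤ)) N, B n,
    add_nonneg (by norm_num) (Finset.sum_nonneg fun n _ => hB0 n), ?_⟩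
  have e1 : ∀ᶠ p : ℂ × ℂ in nhds (u₀, τ₀), τ₀.im / 2 < p.2.im :=
    (Complex.continuous_im.comp continuous_snd).continuousAt.eventually_const_lt
      (by simpa using hτ)
  have e2 : ∀ᶠ p : ℂ × ℂ in nhds (u₀, τ₀), |p.1.im| < |u₀.im| + 1 :=
    (continuous_abs.comp (Complex.continuous_im.comp continuous_fst)).continuousAt.eventually_lt_const
      (by simp)
  have e3 : ∀ᶠ p : ℂ × ℂ in nhds (u₀, τ₀), ∀ n ∈ Finset.Icc (-(N : ℤ)) N,
      1 - expTwoPi (u₀ + n * τ₀) ≠ 0 → 1 - expTwoPi (p.1 + n * p.2) ≠ 0 ∧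
        ‖(1 - expTwoPi (p.1 + n * p.2))⁻¹‖ < B n := by
    rw [Filter.eventually_all_finset]
    intro n _
    by_cases h : 1 - expTwoPi (u₀ + n * τ₀) = 0
    · exact Eventually.of_forall fun p hp => absurd h hp
    · have hc₀ : ContinuousAt (fun p : ℂ × ℂ => 1 - expTwoPi (p.1 + n * p.2)) (u₀, τ₀) :=
        continuousAt_const.sub (continuous_expTwoPi.comp
          (continuous_fst.add (continuous_const.mul continuous_snd))).continuousAt
      have hc := (hc₀.inv₀ h).norm
      have hlt : ‖(1 - expTwoPi (u₀ + n * τ₀))⁻¹‖ < B n := lt_add_one _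
      filter_upwards [Filter.Tendsto.eventually_lt_const hlt hc, hc₀.eventually_ne h]
        with p hp hp' _ using ⟨hp', hp⟩
  filter_upwards [e1, e2, e3] with p h1 h2 h3 n hn
  by_cases hmem : n ∈ Finset.Icc (-(N : ℤ)) N
  · have := Finset.single_le_sum (fun i _ => hB0 i) hmem
    obtain ⟨h4, h5⟩ := h3 n hmem hn
    exact ⟨h4, by linarith⟩
  · have : 1 ≤ |(p.1 + n * p.2).im| := by
      have him : (p.1 + n * p.2).im = p.1.im + n * p.2.im := by simp
      rw [him]
      obtain ⟨h4, h5⟩ := abs_lt.mp h2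
      rw [Finset.mem_Icc, not_and_or, not_le, not_le] at hmem
      have hN0 : (0 : ℝ) ≤ N := Nat.cast_nonneg N
      rcases hmem with h | h
      · have h' : (n : ℝ) ≤ -N := by exact_mod_cast h.le
        refine le_trans ?_ (neg_le_abs _)
        nlinarith
      · have h' : (N : ℝ) ≤ n := by exact_mod_cast h.le
        refine le_trans ?_ (le_abs_self _)
        nlinarith
    refine ⟨one_sub_expTwoPi_ne_zero (abs_pos.mp (by linarith)), ?_⟩
    have h6 := norm_inv_one_sub_expTwoPi_le this
    have h7 := Finset.sum_nonneg fun n (_ : n ∈ Finset.Icc (-(N : ℤ)) N) => hB0 n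
    linarith

lemma exists_norm_inv_one_sub_le (u : ℂ) {τ : ℂ} (hτ : 0 < τ.im) :
    ∃ C : ℝ, 0 ≤ C ∧ ∀ n : ℤ, ‖(1 - expTwoPi (u + n * τ))⁻¹‖ ≤ C := by
  obtain ⟨C, hC0, hC⟩ := exists_eventually_norm_inv_one_sub_le u hτ
  refine ⟨C, hC0, fun n => ?_⟩
  by_cases h : 1 - expTwoPi (u + n * τ) = 0
  · simpa [h] using hC0
  · exact (hC.self_of_nhds n h).2

/-- The Gaussian factor `(-1)^n q^{n²}`. -/
def gaussTerm (τ : ℂ) (n : ℤ) : ℂ := (-1) ^ n * expTwoPi (n ^ 2 * τ)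

lemma norm_gaussTerm_le {τ : ℂ} {y : ℝ} (hy : y ≤ τ.im) (n : ℤ) :
    ‖gaussTerm τ n‖ ≤ Real.exp (-π * (2 * y * n ^ 2 - 2 * 0 * |n|)) := by
  rw [gaussTerm, norm_mul, norm_zpow, norm_neg, norm_one, one_zpow, one_mul, norm_expTwoPi]
  refine Real.exp_le_exp.mpr ?_
  have h1 : ((n : ℂ) ^ 2 * τ).im = n ^ 2 * τ.im := by
    rw [show ((n : ℂ) ^ 2) = (((n : ℝ) ^ 2 : ℝ) : ℂ) by push_cast; rfl, Complex.im_ofReal_mul]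
  rw [h1]
  have h2 : (n : ℝ) ^ 2 * y ≤ n ^ 2 * τ.im := mul_le_mul_of_nonneg_left hy (sq_nonneg _)
  nlinarith [Real.pi_pos]

/-- A summable majorant of `(1 + n²) |q|^{n²}` on `Im τ ≥ y`. -/
def gaussBound (y : ℝ) (n : ℤ) : ℝ :=
  (1 + (n : ℝ) ^ 2) * Real.exp (-π * (2 * y * n ^ 2 - 2 * 0 * |n|))

lemma summable_gaussBound {y : ℝ} (hy : 0 < y) : Summable (gaussBound y) := by
  have h0 := summable_pow_mul_jacobiTheta₂_term_bound 0 (by positivity : 0 < 2 * y) 0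
  have h2 := summable_pow_mul_jacobiTheta₂_term_bound 0 (by positivity : 0 < 2 * y) 2
  refine (h0.add h2).congr fun n => ?_
  simp only [gaussBound, pow_zero, one_mul, add_mul]
  norm_num [sq_abs]

lemma mul_norm_gaussTerm_le {τ : ℂ} {y : ℝ} (hy : y ≤ τ.im) (n : ℤ) :
    (1 + (n : ℝ) ^ 2) * ‖gaussTerm τ n‖ ≤ gaussBound y n :=
  mul_le_mul_of_nonneg_left (norm_gaussTerm_le hy n) (by positivity)

/-! ### Lerch sums -/

/-- The function `v ↦ 1 / (1 - e^{2πiv})`. -/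
def poleFun (v : ℂ) : ℂ := (1 - expTwoPi v)⁻¹

/-- The constant `(-1;q)_∞ / (q;q)_∞`. -/
def lerchConst (τ : ℂ) : ℂ :=
  qPochInf (-1) (expTwoPi τ) / qPochInf (expTwoPi τ) (expTwoPi τ)

/-- The theta constant `∑ (-1)^n q^{n²}`. -/
def thetaFour (τ : ℂ) : ℂ := ∑' n : ℤ, gaussTerm τ n

lemma expTwoPi_add_int_mul (u τ : ℂ) (n : ℤ) :
    expTwoPi (u + n * τ) = expTwoPi u * expTwoPi τ ^ n := by
  rw [expTwoPi_add, expTwoPi_int_mul]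

lemma gaussTerm_eq (τ : ℂ) (r : ℤ) :
    gaussTerm τ r = (-1) ^ r * (triPow (expTwoPi τ) r ^ 2 * expTwoPi τ ^ r) := by
  rw [triPow_sq (expTwoPi_ne_zero τ), gaussTerm, ← expTwoPi_int_mul]
  push_cast
  rfl

lemma gaussTerm_neg (τ : ℂ) (n : ℤ) : gaussTerm τ (-n) = gaussTerm τ n := by
  simp [gaussTerm, zpow_neg, ← inv_zpow, inv_neg]

lemma one_add_expTwoPi_zpow_ne_zero {τ : ℂ} (hτ : 0 < τ.im) (r : ℤ) : 1 + expTwoPi τ ^ r ≠ 0 := by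
  rcases eq_or_ne r 0 with rfl | hr
  · norm_num
  · have h := one_sub_expTwoPi_ne_zero (v := 1 / 2 + r * τ) (by simpa using ⟨hr, hτ.ne'⟩)
    rwa [expTwoPi_add_int_mul, expTwoPi_half, neg_one_mul, sub_neg_eq_add] at h

lemma exists_norm_inv_one_add_zpow_le {τ : ℂ} (hτ : 0 < τ.im) :
    ∃ C : ℝ, 0 ≤ C ∧ ∀ n : ℤ, ‖(1 + expTwoPi τ ^ n)⁻¹‖ ≤ C := by
  obtain ⟨C, h0, hC⟩ := exists_norm_inv_one_sub_le (1 / 2) hτ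
  refine ⟨C, h0, fun n => ?_⟩
  have := hC n
  rwa [expTwoPi_add_int_mul, expTwoPi_half, neg_one_mul, sub_neg_eq_add] at this

/-- The coefficient of the Lerch sum for `N*(1,0,z;q)`. -/
def lerchCoeff (τ : ℂ) (r : ℤ) : ℂ := expTwoPi τ ^ r * (1 + expTwoPi τ ^ r)⁻¹

lemma exists_norm_lerchCoeff_le {τ : ℂ} (hτ : 0 < τ.im) :
    ∃ C : ℝ, 0 ≤ C ∧ ∀ n : ℤ, ‖lerchCoeff τ n‖ ≤ C := by
  obtain ⟨C, h0, hC⟩ := exists_norm_inv_one_add_zpow_le hτ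
  refine ⟨C, h0, fun n => ?_⟩
  convert hC (-n) using 2
  have h1 := one_add_expTwoPi_zpow_ne_zero hτ n
  have h2 := zpow_ne_zero n (expTwoPi_ne_zero τ)
  have h3 : 1 + (expTwoPi τ ^ n)⁻¹ ≠ 0 := by
    rw [← zpow_neg]; exact one_add_expTwoPi_zpow_ne_zero hτ (-n)
  rw [lerchCoeff, zpow_neg, ← div_eq_mul_inv, div_eq_iff h1, eq_comm, inv_mul_eq_iff_eq_mul₀ h3]
  field_simp
  ring

lemma poleFun_add_int_mul (u τ : ℂ) (n : ℤ) :
    poleFun (u + n * τ) = (1 - expTwoPi u * expTwoPi τ ^ n)⁻¹ := by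
  rw [poleFun, expTwoPi_add_int_mul]

lemma tsum_lerchCoeff {τ u : ℂ} (hτ : 0 < τ.im) (hu : ∀ n : ℤ, 1 - expTwoPi (u + n * τ) ≠ 0) :
    (Summable fun r : ℤ => gaussTerm τ r * (lerchCoeff τ r * poleFun (u + r * τ))) ∧
    nStar10 (expTwoPi u) (expTwoPi τ) = lerchConst τ *
      ∑' r : ℤ, gaussTerm τ r * (lerchCoeff τ r * poleFun (u + r * τ)) := by
  obtain ⟨C, hC0, hC⟩ := exists_norm_inv_one_sub_le u hτ
  simp only [expTwoPi_add_int_mul] at hC hu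
  have hq := expTwoPi_ne_zero τ
  have hq1 := norm_expTwoPi_lt_one hτ
  have hne := one_add_expTwoPi_zpow_ne_zero hτ
  have hz := expTwoPi_ne_zero u
  simp only [poleFun_add_int_mul, lerchCoeff, lerchConst, gaussTerm_eq]
  set q := expTwoPi τ
  set z := expTwoPi u
  have ha : ∀ r : ℤ, ‖(-1) ^ r * triPow q r * q ^ r / (1 - z * q ^ r)‖ ≤ C := by
    intro r
    rw [mul_assoc, triPow_mul_zpow hq, div_eq_mul_inv, norm_mul, norm_mul, norm_zpow, norm_neg,
      norm_one, one_zpow, one_mul]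
    calc _ ≤ 1 * C := mul_le_mul (norm_triPow_le_one hq1 _) (hC r) (norm_nonneg _) zero_le_one
      _ = C := one_mul _
  have h := tsum_rankNum_mul_tsum hq hq1 ha hne
  have hK : qPochInf (-1) q / qPochInf q q ≠ 0 := by
    refine div_ne_zero (qPochInf_ne_zero hq1 fun j => ?_) (qPochInf_ne_zero_of_norm_lt hq1 hq1)
    have := hne j
    rw [zpow_natCast] at this
    rwa [neg_one_mul, sub_neg_eq_add]
  have e : ∀ r : ℤ, (-1) ^ r * triPow q r * q ^ r / (1 - z * q ^ r) * (triPow q r * q ^ r) /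
      (1 + q ^ r) = (-1) ^ r * (triPow q r ^ 2 * q ^ r) *
        (q ^ r * (1 + q ^ r)⁻¹ * (1 - z * q ^ r)⁻¹) := fun r => by
    simp only [div_eq_mul_inv]; ring
  simp only [e] at h
  refine ⟨(summable_mul_left_iff hK).mp h.1, ?_⟩
  rw [← tsum_mul_left, ← h.2, nStar10, nGen10, ← tsum_div_const]
  refine tsum_congr fun n => ?_
  rw [partial_fraction hq hq1 hz hu n, rankNum]
  simp only [div_eq_mul_inv, mul_inv]
  ring

lemma tsum_gaussTerm_div {τ : ℂ} (hτ : 0 < τ.im) :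
    (Summable fun r : ℤ => gaussTerm τ r * (1 + expTwoPi τ ^ r)⁻¹) ∧
    lerchConst τ *
      ∑' r : ℤ, gaussTerm τ r * (1 + expTwoPi τ ^ r)⁻¹ = 1 := by
  have hq := expTwoPi_ne_zero τ
  have hq1 := norm_expTwoPi_lt_one hτ
  have hne := one_add_expTwoPi_zpow_ne_zero hτ
  simp only [gaussTerm_eq, lerchConst]
  set q := expTwoPi τ
  have ha : ∀ r : ℤ, ‖(-1) ^ r * triPow q r‖ ≤ 1 := by
    intro r
    rw [norm_mul, norm_zpow, norm_neg, norm_one, one_zpow, one_mul]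
    exact norm_triPow_le_one hq1 _
  have h := tsum_rankNum_mul_tsum hq hq1 ha hne
  have hK : qPochInf (-1) q / qPochInf q q ≠ 0 := by
    refine div_ne_zero (qPochInf_ne_zero hq1 fun j => ?_) (qPochInf_ne_zero_of_norm_lt hq1 hq1)
    have := hne j
    rw [zpow_natCast] at this
    rwa [neg_one_mul, sub_neg_eq_add]
  have e : ∀ r : ℤ, (-1) ^ r * triPow q r * (triPow q r * q ^ r) /
      (1 + q ^ r) = (-1) ^ r * (triPow q r ^ 2 * q ^ r) * (1 + q ^ r)⁻¹ := fun r => by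
    simp only [div_eq_mul_inv]; ring
  simp only [e] at h
  refine ⟨(summable_mul_left_iff hK).mp h.1, ?_⟩
  rw [← tsum_mul_left, ← h.2, tsum_eq_single 0]
  · rw [tsum_eq_single 0]
    · simp [rankNum, qPochN, triPow_zero, invQFact_zero]
    · intro r hr
      rcases lt_or_gt_of_ne hr with h0 | h0
      · rw [invQFact_of_neg q (m := ((0 : ℕ) : ℤ) + r) (by simpa using h0), mul_zero]
      · rw [invQFact_of_neg q (m := ((0 : ℕ) : ℤ) - r) (by simpa using h0), mul_zero, zero_mul]
  · intro n hn
    have h0 := tsum_binomTerm_eq_zero hq hq1 n 0 (by lia) n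
    simp only [binomTerm, zero_mul, zpow_zero, mul_one, zero_add] at h0
    rw [h0, mul_zero]

lemma tsum_lerch {τ u : ℂ} (hτ : 0 < τ.im) (hu : ∀ n : ℤ, 1 - expTwoPi (u + n * τ) ≠ 0) :
    (1 + expTwoPi u) * nStar10 (expTwoPi u) (expTwoPi τ) + 1 = lerchConst τ * ∑' r : ℤ, gaussTerm τ r * poleFun (u + r * τ) := by
  obtain ⟨hA, hA'⟩ := tsum_lerchCoeff hτ hu
  obtain ⟨hB, hB'⟩ := tsum_gaussTerm_div hτ
  rw [hA']
  nth_rewrite 2 [← hB']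
  rw [mul_left_comm, ← mul_add, ← tsum_mul_left,
    ← (hA.mul_left (1 + expTwoPi u)).tsum_add hB]
  congr 1
  refine tsum_congr fun r => ?_
  have h1 := hu r
  have h2 := one_add_expTwoPi_zpow_ne_zero hτ r
  rw [poleFun_add_int_mul, lerchCoeff]
  rw [expTwoPi_add_int_mul] at h1
  field_simp
  ring

lemma const_mul_thetaFour {τ : ℂ} (hτ : 0 < τ.im) :
    lerchConst τ * thetaFour τ = 2 := by
  obtain ⟨hB, hB'⟩ := tsum_gaussTerm_div hτ
  have hC : Summable fun r : ℤ => gaussTerm τ (-r) * (1 + expTwoPi τ ^ (-r))⁻¹ :=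
    (Equiv.neg ℤ).summable_iff.mpr hB
  have hC' : ∑' r : ℤ, gaussTerm τ (-r) * (1 + expTwoPi τ ^ (-r))⁻¹ = _ :=
    (Equiv.neg ℤ).tsum_eq (fun r : ℤ => gaussTerm τ r * (1 + expTwoPi τ ^ r)⁻¹)
  have h : thetaFour τ = ∑' r : ℤ, gaussTerm τ r * (1 + expTwoPi τ ^ r)⁻¹ +
      ∑' r : ℤ, gaussTerm τ (-r) * (1 + expTwoPi τ ^ (-r))⁻¹ := by
    rw [← hB.tsum_add hC]
    refine tsum_congr fun r => ?_
    have h1 := one_add_expTwoPi_zpow_ne_zero hτ r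
    have h2 := zpow_ne_zero r (expTwoPi_ne_zero τ)
    have h3 : 1 + (expTwoPi τ ^ r)⁻¹ ≠ 0 := by
      rw [← zpow_neg]; exact one_add_expTwoPi_zpow_ne_zero hτ (-r)
    have h4 : (1 + expTwoPi τ ^ r)⁻¹ + (1 + (expTwoPi τ ^ r)⁻¹)⁻¹ = 1 := by
      generalize expTwoPi τ ^ r = x at *
      have h5 : 1 + x⁻¹ = (1 + x) / x := by field_simp; ring
      rw [h5, inv_div, inv_eq_one_div, ← add_div, div_self h1]
    rw [gaussTerm_neg, zpow_neg, ← mul_add, h4, mul_one]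
  rw [h, hC', mul_add, hB']
  norm_num

lemma thetaFour_ne_zero {τ : ℂ} (hτ : 0 < τ.im) : thetaFour τ ≠ 0 :=
  right_ne_zero_of_mul ((const_mul_thetaFour hτ).trans_ne two_ne_zero)

/-! ### Termwise differentiation -/

lemma hasDerivAt_poleFun {v : ℂ} (hv : 1 - expTwoPi v ≠ 0) :
    HasDerivAt poleFun (2 * π * I * (poleFun v ^ 2 - poleFun v)) v := by
  have h := ((hasDerivAt_expTwoPi v).const_sub 1).inv hv
  refine h.congr_deriv ?_
  rw [poleFun]
  field_simp
  ring

lemma hasDerivAt_tsum_of_eventually {F : ℤ → ℂ → ℂ} {F' : ℤ → ℂ} {b : ℤ → ℝ} (hb : Summable b)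
    {s : ℂ} (h : ∀ᶠ t in nhds s, ∀ n, DifferentiableAt ℂ (F n) t ∧ ‖F n t‖ ≤ b n)
    (hF : ∀ n, HasDerivAt (F n) (F' n) s) :
    Summable F' ∧ HasDerivAt (fun t => ∑' n, F n t) (∑' n, F' n) s := by
  obtain ⟨U, hU, hUo, hs⟩ := eventually_nhds_iff.mp h
  have hd : ∀ n, DifferentiableOn ℂ (F n) U := fun n t ht =>
    (hU t ht n).1.differentiableWithinAt
  have h1 := Complex.hasSum_deriv_of_summable_norm hb hd hUo (fun n t ht => (hU t ht n).2) hs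
  have h2 := (Complex.differentiableOn_tsum_of_summable_norm hb hd hUo
    (fun n t ht => (hU t ht n).2)).differentiableAt (hUo.mem_nhds hs)
  simp only [(hF _).deriv] at h1
  exact ⟨h1.summable, h1.tsum_eq ▸ h2.hasDerivAt⟩

/-- A family of entire functions, locally bounded with at most quadratic growth in the index. -/
def QuadBounded (f : ℤ → ℂ → ℂ) : Prop :=
  (∀ n, Differentiable ℂ (f n)) ∧
    ∀ C : ℝ, ∃ M : ℝ, ∀ (n : ℤ) (w : ℂ), ‖w‖ ≤ C → ‖f n w‖ ≤ (1 + (n : ℝ) ^ 2) * M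

lemma QuadBounded.mul {c : ℤ → ℂ} {B : ℝ} (hc : ∀ n : ℤ, ‖c n‖ ≤ (1 + (n : ℝ) ^ 2) * B)
    {g : ℂ → ℂ} (hg : Differentiable ℂ g) : QuadBounded fun n w => c n * g w := by
  refine ⟨fun n => hg.const_mul _, fun C => ?_⟩
  obtain ⟨M, hM⟩ := (isCompact_closedBall (0 : ℂ) C).exists_bound_of_continuousOn
    hg.continuous.continuousOn
  refine ⟨B * M, fun n w hw => ?_⟩
  rw [norm_mul, ← mul_assoc]
  exact mul_le_mul (hc n) (hM w (by simpa using hw)) (norm_nonneg _)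
    ((norm_nonneg _).trans (hc n))

lemma QuadBounded.add {f g : ℤ → ℂ → ℂ} (hf : QuadBounded f) (hg : QuadBounded g) :
    QuadBounded fun n w => f n w + g n w := by
  refine ⟨fun n => (hf.1 n).add (hg.1 n), fun C => ?_⟩
  obtain ⟨M, hM⟩ := hf.2 C
  obtain ⟨N, hN⟩ := hg.2 C
  refine ⟨M + N, fun n w hw => (norm_add_le _ _).trans ?_⟩
  rw [mul_add]
  exact add_le_add (hM n w hw) (hN n w hw)

lemma exists_summable_bound {u τ : ℂ} (hτ : 0 < τ.im) {f : ℤ → ℂ → ℂ} (hf : QuadBounded f)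
    (hne : ∀ n, f n = 0 ∨ 1 - expTwoPi (u + n * τ) ≠ 0) :
    ∃ b : ℤ → ℝ, Summable b ∧ ∀ᶠ p : ℂ × ℂ in nhds (u, τ), ∀ n : ℤ,
      (f n = 0 ∨ 1 - expTwoPi (p.1 + n * p.2) ≠ 0) ∧
      ‖gaussTerm p.2 n * f n (poleFun (p.1 + n * p.2))‖ ≤ b n := by
  obtain ⟨C, hC0, hC⟩ := exists_eventually_norm_inv_one_sub_le u hτ
  obtain ⟨M, hM⟩ := hf.2 C
  have hM0 : 0 ≤ M := by
    have := (norm_nonneg _).trans (hM 0 0 (by simpa using hC0))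
    simpa using this
  have e1 : ∀ᶠ p : ℂ × ℂ in nhds (u, τ), τ.im / 2 < p.2.im :=
    (Complex.continuous_im.comp continuous_snd).continuousAt.eventually_const_lt
      (by simpa using hτ)
  refine ⟨fun n => gaussBound (τ.im / 2) n * M,
    (summable_gaussBound (by linarith)).mul_right M, ?_⟩
  filter_upwards [hC, e1] with p hp h1 n
  have hg := mul_norm_gaussTerm_le h1.le n
  have hg0 : 0 ≤ gaussBound (τ.im / 2) n := le_trans (by positivity) hg
  rcases hne n with h | h
  · exact ⟨Or.inl h, by simpa [h] using mul_nonneg hg0 hM0⟩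
  · obtain ⟨h2, h3⟩ := hp n h
    refine ⟨Or.inr h2, ?_⟩
    rw [norm_mul]
    calc _ ≤ ‖gaussTerm p.2 n‖ * ((1 + (n : ℝ) ^ 2) * M) :=
          mul_le_mul_of_nonneg_left (hM n _ h3) (norm_nonneg _)
      _ = (1 + (n : ℝ) ^ 2) * ‖gaussTerm p.2 n‖ * M := by ring
      _ ≤ _ := mul_le_mul_of_nonneg_right hg hM0

lemma eventually_one_sub_ne_zero {u τ : ℂ} (hτ : 0 < τ.im)
    (hu : ∀ n : ℤ, 1 - expTwoPi (u + n * τ) ≠ 0) :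
    ∀ᶠ p : ℂ × ℂ in nhds (u, τ), ∀ n : ℤ, 1 - expTwoPi (p.1 + n * p.2) ≠ 0 := by
  obtain ⟨C, -, hC⟩ := exists_eventually_norm_inv_one_sub_le u hτ
  filter_upwards [hC] with p hp n using (hp n (hu n)).1

lemma tendsto_prodMk_left (u τ : ℂ) : Tendsto (fun w : ℂ => (w, τ)) (nhds u) (nhds (u, τ)) :=
  (continuous_id.prodMk continuous_const).tendsto u

lemma tendsto_prodMk_right (u τ : ℂ) : Tendsto (fun t : ℂ => (u, t)) (nhds τ) (nhds (u, τ)) :=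
  (continuous_const.prodMk continuous_id).tendsto τ

lemma hasDerivAt_gaussTerm (τ : ℂ) (n : ℤ) :
    HasDerivAt (fun t => gaussTerm t n) (2 * π * I * (n ^ 2 * gaussTerm τ n)) τ := by
  have h := ((hasDerivAt_expTwoPi (n ^ 2 * τ)).comp τ
    ((hasDerivAt_id τ).const_mul ((n : ℂ) ^ 2))).const_mul ((-1 : ℂ) ^ n)
  refine h.congr_deriv ?_
  rw [gaussTerm]
  ring

lemma summable_lerch {u τ : ℂ} (hτ : 0 < τ.im) {f : ℤ → ℂ → ℂ} (hf : QuadBounded f)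
    (hne : ∀ n, f n = 0 ∨ 1 - expTwoPi (u + n * τ) ≠ 0) :
    Summable fun n : ℤ => gaussTerm τ n * f n (poleFun (u + n * τ)) := by
  obtain ⟨b, hb, h⟩ := exists_summable_bound hτ hf hne
  exact hb.of_norm_bounded fun n => (h.self_of_nhds n).2

lemma hasDerivAt_tsum_left {u τ : ℂ} (hτ : 0 < τ.im) {f : ℤ → ℂ → ℂ} (hf : QuadBounded f)
    (hne : ∀ n, f n = 0 ∨ 1 - expTwoPi (u + n * τ) ≠ 0) :
    HasDerivAt (fun v => ∑' n : ℤ, gaussTerm τ n * f n (poleFun (v + n * τ)))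
      (2 * π * I * ∑' n : ℤ, gaussTerm τ n * (deriv (f n) (poleFun (u + n * τ)) *
        (poleFun (u + n * τ) ^ 2 - poleFun (u + n * τ)))) u := by
  obtain ⟨b, hb, h⟩ := exists_summable_bound hτ hf hne
  have key : ∀ (n : ℤ) (v : ℂ), (f n = 0 ∨ 1 - expTwoPi (v + n * τ) ≠ 0) →
      HasDerivAt (fun v => gaussTerm τ n * f n (poleFun (v + n * τ)))
        (2 * π * I * (gaussTerm τ n * (deriv (f n) (poleFun (v + n * τ)) *
        (poleFun (v + n * τ) ^ 2 - poleFun (v + n * τ))))) v := by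
    rintro n v (hv | hv)
    · simpa [hv] using hasDerivAt_const v (0 : ℂ)
    · have h1 := (hasDerivAt_poleFun hv).comp v ((hasDerivAt_id v).add_const ((n : ℂ) * τ))
      have h2 := (((hf.1 n) (poleFun (v + n * τ))).hasDerivAt.comp v h1).const_mul (gaussTerm τ n)
      exact h2.congr_deriv (by ring)
  have := (hasDerivAt_tsum_of_eventually hb (s := u)
    (F := fun n v => gaussTerm τ n * f n (poleFun (v + n * τ)))
    (((tendsto_prodMk_left u τ).eventually h).mono fun v hv n =>
      ⟨(key n v (hv n).1).differentiableAt, (hv n).2⟩) (fun n => key n u (hne n))).2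
  rwa [tsum_mul_left] at this

lemma hasDerivAt_tsum_right {u τ : ℂ} (hτ : 0 < τ.im) {f : ℤ → ℂ → ℂ} (hf : QuadBounded f)
    (hne : ∀ n, f n = 0 ∨ 1 - expTwoPi (u + n * τ) ≠ 0) :
    HasDerivAt (fun t => ∑' n : ℤ, gaussTerm t n * f n (poleFun (u + n * t)))
      (2 * π * I * ∑' n : ℤ, gaussTerm τ n * (n ^ 2 * f n (poleFun (u + n * τ)) +
        n * (deriv (f n) (poleFun (u + n * τ)) *
        (poleFun (u + n * τ) ^ 2 - poleFun (u + n * τ))))) τ := by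
  obtain ⟨b, hb, h⟩ := exists_summable_bound hτ hf hne
  have key : ∀ (n : ℤ) (t : ℂ), (f n = 0 ∨ 1 - expTwoPi (u + n * t) ≠ 0) →
      HasDerivAt (fun t => gaussTerm t n * f n (poleFun (u + n * t)))
        (2 * π * I * (gaussTerm t n * (n ^ 2 * f n (poleFun (u + n * t)) +
        n * (deriv (f n) (poleFun (u + n * t)) *
        (poleFun (u + n * t) ^ 2 - poleFun (u + n * t)))))) t := by
    rintro n t (hv | hv)
    · simpa [hv] using hasDerivAt_const t (0 : ℂ)
    · have h1 := (hasDerivAt_poleFun hv).comp t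
        (((hasDerivAt_id t).const_mul (n : ℂ)).const_add u)
      have h2 := (hasDerivAt_gaussTerm t n).mul
        (((hf.1 n) (poleFun (u + n * t))).hasDerivAt.comp t h1)
      exact h2.congr_deriv (by simp only [id, Function.comp]; ring)
  have := (hasDerivAt_tsum_of_eventually hb (s := τ)
    (F := fun n t => gaussTerm t n * f n (poleFun (u + n * t)))
    (((tendsto_prodMk_right u τ).eventually h).mono fun t ht n =>
      ⟨(key n t (ht n).1).differentiableAt, (ht n).2⟩) (fun n => key n τ (hne n))).2
  rwa [tsum_mul_left] at this

/-! ### The differential operator applied to the Lerch sum -/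

/-- The logarithmic-derivative constant `4 δ_q ϑ₄ / ϑ₄`. -/
def thetaLog (τ : ℂ) : ℂ := 4 * (∑' n : ℤ, gaussTerm τ n * n ^ 2) / thetaFour τ

/-- The summand of `lerchPole`, as a function of `w = 1 / (1 - z q^n)`. -/
def poleCoeff (τ : ℂ) (n : ℤ) (w : ℂ) : ℂ :=
  (4 * n ^ 2 - thetaLog τ) * w + 4 * n * (w ^ 2 - w) + (2 * w ^ 3 - 3 * w ^ 2 + w)

/-- The image of the Lerch sum under the differential operator. -/
def lerchPole (τ u : ℂ) : ℂ := ∑' n : ℤ, gaussTerm τ n * poleCoeff τ n (poleFun (u + n * τ))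

lemma one_le_one_add_sq (n : ℤ) : (1 : ℝ) ≤ 1 + (n : ℝ) ^ 2 := by nlinarith [sq_nonneg (n : ℝ)]

lemma quadBounded_of_differentiable {g : ℂ → ℂ} (hg : Differentiable ℂ g) :
    QuadBounded fun _ w => g w := by
  have := QuadBounded.mul (c := fun _ => 1) (B := 1) (fun n => by
    simpa using one_le_one_add_sq n) hg
  simpa only [one_mul] using this

lemma norm_intCast_sq (n : ℤ) : ‖(n : ℂ) ^ 2‖ = (n : ℝ) ^ 2 := by
  rw [norm_pow, Complex.norm_intCast, sq_abs]

lemma norm_intCast_le (n : ℤ) : ‖(n : ℂ)‖ ≤ 1 + (n : ℝ) ^ 2 := by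
  rw [Complex.norm_intCast]
  nlinarith [sq_abs (n : ℝ), sq_nonneg (|(n : ℝ)| - 1), sq_nonneg (|(n : ℝ)| + 1)]

lemma quadBounded_sq_mul : QuadBounded fun n w => (n : ℂ) ^ 2 * w :=
  QuadBounded.mul (c := fun n => (n : ℂ) ^ 2) (B := 1) (fun n => by
    rw [norm_intCast_sq]; linarith) differentiable_id

lemma quadBounded_mul_sub : QuadBounded fun n w => (n : ℂ) * (w ^ 2 - w) :=
  QuadBounded.mul (c := fun n => (n : ℂ)) (B := 1) (fun n => by
    rw [mul_one]; exact norm_intCast_le n) (by fun_prop)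

lemma quadBounded_poleCoeff (τ : ℂ) : QuadBounded (poleCoeff τ) := by
  have h1 := quadBounded_of_differentiable (g := fun w =>
    -thetaLog τ * w + (2 * w ^ 3 - 3 * w ^ 2 + w)) (by fun_prop)
  have h2 := QuadBounded.mul (c := fun n : ℤ => 4 * (n : ℂ) ^ 2) (B := 4) (fun n => by
    rw [norm_mul, norm_intCast_sq, Complex.norm_ofNat]; linarith) differentiable_id
  have h3 := QuadBounded.mul (c := fun n : ℤ => 4 * (n : ℂ)) (B := 4) (fun n => by
    rw [norm_mul, Complex.norm_ofNat]; linarith [norm_intCast_le n])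
    (g := fun w => w ^ 2 - w) (by fun_prop)
  have h := (h1.add h2).add h3
  have e : poleCoeff τ = fun (n : ℤ) (w : ℂ) => -thetaLog τ * w + (2 * w ^ 3 - 3 * w ^ 2 + w) +
      4 * (n : ℂ) ^ 2 * id w + 4 * n * (w ^ 2 - w) := by
    funext n w
    simp only [poleCoeff, id]
    ring
  rwa [e]

lemma hasDerivAt_thetaFour {u τ : ℂ} (hτ : 0 < τ.im)
    (hu : ∀ n : ℤ, 1 - expTwoPi (u + n * τ) ≠ 0) :
    HasDerivAt thetaFour (2 * π * I * ∑' n : ℤ, gaussTerm τ n * n ^ 2) τ := by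
  have h := hasDerivAt_tsum_right hτ (quadBounded_of_differentiable (g := fun _ => 1)
    (differentiable_const _)) (fun n => Or.inr (hu n))
  simp only [deriv_const', zero_mul, mul_zero, add_zero, mul_one] at h
  exact h

lemma deriv_nStar10_right {u τ : ℂ} (hτ : 0 < τ.im)
    (hu : ∀ n : ℤ, 1 - expTwoPi (u + n * τ) ≠ 0) :
    (1 + expTwoPi u) * deriv (fun t => nStar10 (expTwoPi u) (expTwoPi t)) τ =
      2 * π * I * (lerchConst τ * (∑' n : ℤ, gaussTerm τ n * (n ^ 2 * poleFun (u + n * τ) +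
        n * (poleFun (u + n * τ) ^ 2 - poleFun (u + n * τ))) -
        thetaLog τ / 4 * ∑' n : ℤ, gaussTerm τ n * poleFun (u + n * τ))) := by
  have hG := hasDerivAt_tsum_right hτ (quadBounded_of_differentiable (g := fun w => w)
    differentiable_id) (fun n => Or.inr (hu n))
  simp only [deriv_id'', one_mul] at hG
  have hT := hasDerivAt_thetaFour hτ hu
  have h0 := thetaFour_ne_zero hτ
  have hF := ((hG.const_mul 2).div hT h0).sub_const 1
  have hev : (fun t => (1 + expTwoPi u) * nStar10 (expTwoPi u) (expTwoPi t)) =ᶠ[nhds τ]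
      fun t => 2 * (∑' n : ℤ, gaussTerm t n * poleFun (u + n * t)) / thetaFour t - 1 := by
    have e1 : ∀ᶠ t : ℂ in nhds τ, 0 < t.im :=
      Complex.continuous_im.continuousAt.eventually_const_lt hτ
    filter_upwards [e1, (tendsto_prodMk_right u τ).eventually (eventually_one_sub_ne_zero hτ hu)]
      with t ht hut
    rw [eq_sub_iff_add_eq, tsum_lerch ht hut, eq_div_iff (thetaFour_ne_zero ht),
      ← const_mul_thetaFour ht, lerchConst]
    ring
  have hK : lerchConst τ = 2 / thetaFour τ := by
    rw [eq_div_iff h0]; exact const_mul_thetaFour hτ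
  rw [← deriv_const_mul_field, hev.deriv_eq]
  refine hF.deriv.trans ?_
  rw [hK, thetaLog]
  generalize (∑' n : ℤ, gaussTerm τ n * (n ^ 2 * poleFun (u + n * τ) +
        n * (poleFun (u + n * τ) ^ 2 - poleFun (u + n * τ)))) = A
  generalize (∑' n : ℤ, gaussTerm τ n * poleFun (u + n * τ)) = B
  field_simp

lemma eventually_one_sub_ne_zero_left {u τ : ℂ} (hτ : 0 < τ.im)
    (hu : ∀ n : ℤ, 1 - expTwoPi (u + n * τ) ≠ 0) :
    ∀ᶠ v : ℂ in nhds u, ∀ n : ℤ, 1 - expTwoPi (v + n * τ) ≠ 0 :=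
  (tendsto_prodMk_left u τ).eventually (eventually_one_sub_ne_zero hτ hu)

lemma eventually_differentiableAt_nStar10 {u τ : ℂ} (hτ : 0 < τ.im)
    (hu : ∀ n : ℤ, 1 - expTwoPi (u + n * τ) ≠ 0) :
    ∀ᶠ v : ℂ in nhds u, DifferentiableAt ℂ (fun v => nStar10 (expTwoPi v) (expTwoPi τ)) v := by
  have hv := eventually_one_sub_ne_zero_left hτ hu
  obtain ⟨C, hC0, hC⟩ := exists_norm_lerchCoeff_le hτ
  have hf : QuadBounded fun n w => lerchCoeff τ n * w :=
    QuadBounded.mul (B := C) (fun n => (hC n).trans (by nlinarith [one_le_one_add_sq n]))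
      differentiable_id
  filter_upwards [hv.eventually_nhds] with v hv
  have h := ((hasDerivAt_tsum_left hτ hf (fun n => Or.inr (hv.self_of_nhds n))).const_mul
    (lerchConst τ)).differentiableAt
  exact h.congr_of_eventuallyEq (hv.mono fun w hw => (tsum_lerchCoeff hτ hw).2)

lemma deriv_nStar10_left {u τ : ℂ} (hτ : 0 < τ.im)
    (hu : ∀ n : ℤ, 1 - expTwoPi (u + n * τ) ≠ 0) :
    (2 * π * I) ^ 2 * expTwoPi u * nStar10 (expTwoPi u) (expTwoPi τ) +
      2 * (2 * π * I) * expTwoPi u * deriv (fun v => nStar10 (expTwoPi v) (expTwoPi τ)) u +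
      (1 + expTwoPi u) * deriv (deriv fun v => nStar10 (expTwoPi v) (expTwoPi τ)) u =
      (2 * π * I) ^ 2 * (lerchConst τ * ∑' n : ℤ, gaussTerm τ n *
        (2 * poleFun (u + n * τ) ^ 3 - 3 * poleFun (u + n * τ) ^ 2 + poleFun (u + n * τ))) := by
  set N : ℂ → ℂ := fun v => nStar10 (expTwoPi v) (expTwoPi τ) with hN
  have hd := eventually_differentiableAt_nStar10 hτ hu
  have hd2 : DifferentiableAt ℂ (deriv N) u :=
    (Complex.analyticAt_iff_eventually_differentiableAt.mpr hd).deriv.differentiableAt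
  have hv := eventually_one_sub_ne_zero_left hτ hu
  have h1 : (fun v => 2 * π * I * expTwoPi v * N v + (1 + expTwoPi v) * deriv N v) =ᶠ[nhds u]
      fun v => 2 * π * I * (lerchConst τ * ∑' n : ℤ, gaussTerm τ n *
        (poleFun (v + n * τ) ^ 2 - poleFun (v + n * τ))) := by
    filter_upwards [hd, hv.eventually_nhds] with v hdv hvv
    have hG := hasDerivAt_tsum_left hτ (quadBounded_of_differentiable (g := fun w => w)
      differentiable_id) (fun n => Or.inr (hvv.self_of_nhds n))
    simp only [deriv_id'', one_mul] at hG
    have e : (fun w => (1 + expTwoPi w) * N w) =ᶠ[nhds v]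
        fun w => lerchConst τ * ∑' n : ℤ, gaussTerm τ n * poleFun (w + n * τ) - 1 :=
      hvv.mono fun w hw => by
        dsimp only
        rw [eq_sub_iff_add_eq, hN, tsum_lerch hτ hw]
    have h2 := ((hasDerivAt_expTwoPi v).const_add 1).mul hdv.hasDerivAt
    have h3 := ((hG.const_mul (lerchConst τ)).sub_const 1).congr_of_eventuallyEq e
    rw [h2.unique h3]
    ring
  have h2 := (((hasDerivAt_expTwoPi u).const_mul (2 * π * I)).mul
    hd.self_of_nhds.hasDerivAt).add (((hasDerivAt_expTwoPi u).const_add 1).mul hd2.hasDerivAt)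
  have hG := hasDerivAt_tsum_left hτ (quadBounded_of_differentiable (g := fun w => w ^ 2 - w)
      (by fun_prop)) (fun n => Or.inr (hu n))
  have h3 := ((hG.const_mul (lerchConst τ)).const_mul (2 * π * I)).congr_of_eventuallyEq h1
  have h4 := h2.unique h3
  have hder : ∀ w : ℂ, deriv (fun w : ℂ => w ^ 2 - w) w * (w ^ 2 - w) =
      2 * w ^ 3 - 3 * w ^ 2 + w := by
    intro w
    have : HasDerivAt (fun w : ℂ => w ^ 2 - w) (2 * w - 1) w := by
      have h := (hasDerivAt_pow 2 w).sub (hasDerivAt_id w)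
      exact h.congr_deriv (by norm_num)
    rw [this.deriv]
    ring
  simp only [hder] at h4
  linear_combination h4

lemma operator_nStar10 {u τ : ℂ} (hτ : 0 < τ.im)
    (hu : ∀ n : ℤ, 1 - expTwoPi (u + n * τ) ≠ 0) :
    2 * (1 + expTwoPi u) * ((2 * π * I)⁻¹ *
        deriv (fun t => nStar10 (expTwoPi u) (expTwoPi t)) τ) +
      (expTwoPi u / 2) * nStar10 (expTwoPi u) (expTwoPi τ) +
      expTwoPi u * ((2 * π * I)⁻¹ * deriv (fun v => nStar10 (expTwoPi v) (expTwoPi τ)) u) +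
      (1 / 2) * (1 + expTwoPi u) * ((2 * π * I)⁻¹) ^ 2 *
        iteratedDeriv 2 (fun v => nStar10 (expTwoPi v) (expTwoPi τ)) u =
      lerchConst τ / 2 * lerchPole τ u := by
  have h1 := deriv_nStar10_right hτ hu
  have h2 := deriv_nStar10_left hτ hu
  have s1 := summable_lerch hτ (quadBounded_sq_mul.add quadBounded_mul_sub)
    (fun n => Or.inr (hu n))
  have s2 := summable_lerch hτ (quadBounded_of_differentiable (g := fun w => w)
    differentiable_id) (fun n => Or.inr (hu n))
  have s3 := summable_lerch hτ (quadBounded_of_differentiable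
    (g := fun w => 2 * w ^ 3 - 3 * w ^ 2 + w) (by fun_prop)) (fun n => Or.inr (hu n))
  have hS : lerchPole τ u = 4 * ∑' n : ℤ, gaussTerm τ n * (n ^ 2 * poleFun (u + n * τ) +
        n * (poleFun (u + n * τ) ^ 2 - poleFun (u + n * τ))) -
        thetaLog τ * ∑' n : ℤ, gaussTerm τ n * poleFun (u + n * τ) +
        ∑' n : ℤ, gaussTerm τ n *
        (2 * poleFun (u + n * τ) ^ 3 - 3 * poleFun (u + n * τ) ^ 2 + poleFun (u + n * τ)) := by
    rw [← tsum_mul_left, ← tsum_mul_left, ← (s1.mul_left 4).tsum_sub (s2.mul_left _),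
      ← ((s1.mul_left 4).sub (s2.mul_left (thetaLog τ))).tsum_add s3, lerchPole]
    refine tsum_congr fun n => ?_
    rw [poleCoeff]
    ring
  rw [iteratedDeriv_succ, iteratedDeriv_one, hS]
  have hc := Complex.two_pi_I_ne_zero
  set c : ℂ := 2 * π * I
  set D₁ := deriv (fun t => nStar10 (expTwoPi u) (expTwoPi t)) τ
  set D₂ := deriv (fun v => nStar10 (expTwoPi v) (expTwoPi τ)) u
  set D₃ := deriv (deriv fun v => nStar10 (expTwoPi v) (expTwoPi τ)) u
  have aux₁ : ∀ X, (1 + expTwoPi u) * D₁ = c * X → (1 + expTwoPi u) * (c⁻¹ * D₁) = X := by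
    intro X hX
    rw [mul_left_comm, hX, inv_mul_cancel_left₀ hc]
  have aux₂ : ∀ X, c ^ 2 * expTwoPi u * nStar10 (expTwoPi u) (expTwoPi τ) +
      2 * c * expTwoPi u * D₂ + (1 + expTwoPi u) * D₃ = c ^ 2 * X →
      expTwoPi u * nStar10 (expTwoPi u) (expTwoPi τ) + 2 * expTwoPi u * (c⁻¹ * D₂) +
      (1 + expTwoPi u) * (c⁻¹ ^ 2 * D₃) = X := by
    intro X hX
    refine mul_left_cancel₀ (pow_ne_zero 2 hc) (Eq.trans ?_ hX)
    field_simp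
  linear_combination 2 * aux₁ _ h1 + aux₂ _ h2 / 2

/-! ### Transformation behaviour and singularities of `lerchPole` -/

lemma gaussTerm_sub_one (τ : ℂ) (n : ℤ) :
    gaussTerm τ (n - 1) = -(gaussTerm τ n * (expTwoPi τ * ((expTwoPi τ ^ n)⁻¹) ^ 2)) := by
  have e : (((n - 1 : ℤ) : ℂ) ^ 2 * τ) = n ^ 2 * τ + (τ + ((-n : ℤ) * τ + (-n : ℤ) * τ)) := by
    push_cast; ring
  rw [gaussTerm, e, expTwoPi_add, expTwoPi_add, expTwoPi_add, expTwoPi_int_mul, zpow_neg,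
    zpow_sub_one₀ (by norm_num), gaussTerm]
  norm_num
  ring

lemma tsum_gaussTerm_mul_sub {u τ : ℂ} (hτ : 0 < τ.im)
    (hu : ∀ n : ℤ, 1 - expTwoPi (u + n * τ) ≠ 0) :
    (Summable fun n : ℤ => gaussTerm τ n * (4 * n ^ 2 - thetaLog τ)) ∧
    ∑' n : ℤ, gaussTerm τ n * (4 * (n : ℂ) ^ 2 - thetaLog τ) = 0 := by
  have s1 : Summable fun n : ℤ => gaussTerm τ n := by
    simpa using summable_lerch hτ (quadBounded_of_differentiable (g := fun _ => 1)
      (differentiable_const _)) (fun n => Or.inr (hu n))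
  have s2 : Summable fun n : ℤ => gaussTerm τ n * n ^ 2 := by
    simpa using summable_lerch hτ (QuadBounded.mul (c := fun n : ℤ => (n : ℂ) ^ 2) (B := 1)
      (fun n => by rw [norm_intCast_sq]; linarith) (g := fun _ => 1)
      (differentiable_const _)) (fun n => Or.inr (hu n))
  have e : (fun n : ℤ => gaussTerm τ n * (4 * (n : ℂ) ^ 2 - thetaLog τ)) =
      fun n : ℤ => 4 * (gaussTerm τ n * n ^ 2) - thetaLog τ * gaussTerm τ n := by
    funext n; ring
  rw [e]
  refine ⟨(s2.mul_left 4).sub (s1.mul_left _), ?_⟩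
  rw [(s2.mul_left 4).tsum_sub (s1.mul_left _), tsum_mul_left, tsum_mul_left, thetaLog, thetaFour]
  have := thetaFour_ne_zero hτ
  rw [thetaFour] at this
  field_simp
  ring

lemma poleFun_add_one (v : ℂ) : poleFun (v + 1) = poleFun v := by
  rw [poleFun, expTwoPi_add, expTwoPi_one, mul_one, poleFun]

lemma poleFun_neg {v : ℂ} (hv : 1 - expTwoPi v ≠ 0) : poleFun (-v) = 1 - poleFun v := by
  have h := expTwoPi_ne_zero v
  have h' : expTwoPi v - 1 ≠ 0 := by rwa [← neg_ne_zero, neg_sub]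
  rw [poleFun, poleFun, expTwoPi_neg]
  have : 1 - (expTwoPi v)⁻¹ = (expTwoPi v - 1) / expTwoPi v := by field_simp
  rw [this]
  field_simp
  ring

lemma lerchPole_add_one (τ u : ℂ) : lerchPole τ (u + 1) = lerchPole τ u := by
  refine tsum_congr fun n => ?_
  rw [add_right_comm, poleFun_add_one]

lemma summable_poleCoeff {u τ : ℂ} (hτ : 0 < τ.im)
    (hu : ∀ n : ℤ, 1 - expTwoPi (u + n * τ) ≠ 0) :
    Summable fun n : ℤ => gaussTerm τ n * poleCoeff τ n (poleFun (u + n * τ)) :=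
  summable_lerch hτ (quadBounded_poleCoeff τ) (fun n => Or.inr (hu n))

lemma lerchPole_neg {u τ : ℂ} (hτ : 0 < τ.im)
    (hu : ∀ n : ℤ, 1 - expTwoPi (u + n * τ) ≠ 0) : lerchPole τ (-u) = -lerchPole τ u := by
  obtain ⟨h1, h2⟩ := tsum_gaussTerm_mul_sub hτ hu
  have h3 := summable_poleCoeff hτ hu
  have h4 : lerchPole τ (-u) = ∑' n : ℤ, gaussTerm τ (-n) *
      poleCoeff τ (-n) (poleFun (-u + (-n : ℤ) * τ)) :=
    ((Equiv.neg ℤ).tsum_eq fun n : ℤ => gaussTerm τ n *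
      poleCoeff τ n (poleFun (-u + n * τ))).symm
  rw [h4, lerchPole, ← zero_sub (∑' n : ℤ, _), ← h2, ← h1.tsum_sub h3]
  refine tsum_congr fun n => ?_
  rw [gaussTerm_neg, show -u + ((-n : ℤ) : ℂ) * τ = -(u + n * τ) by push_cast; ring,
    poleFun_neg (hu n), poleCoeff, poleCoeff]
  push_cast
  ring

lemma poleCoeff_sub {c n w x : ℂ} (hx : x ≠ 0) (hx1 : 1 - x ≠ 0) (hw : w = (1 - x)⁻¹) :
    (x⁻¹) ^ 2 * ((4 * (n - 1) ^ 2 - c) * w + 4 * (n - 1) * (w ^ 2 - w) +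
      (2 * w ^ 3 - 3 * w ^ 2 + w)) =
    ((4 * n ^ 2 - c) * w + 4 * n * (w ^ 2 - w) + (2 * w ^ 3 - 3 * w ^ 2 + w)) +
      (4 * (n - 1) ^ 2 - c) * (x⁻¹) ^ 2 + ((2 * n - 1) ^ 2 - c) * x⁻¹ := by
  subst hw
  field_simp
  ring

lemma lerchPole_add_self {u τ : ℂ} (hτ : 0 < τ.im)
    (hu : ∀ n : ℤ, 1 - expTwoPi (u + n * τ) ≠ 0) :
    lerchPole τ (u + τ) = -(expTwoPi τ * expTwoPi u ^ 2) * lerchPole τ u := by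
  obtain ⟨h1, h2⟩ := tsum_gaussTerm_mul_sub hτ hu
  have h3 := summable_poleCoeff hτ hu
  have hu' : ∀ n : ℤ, 1 - expTwoPi (u + τ + n * τ) ≠ 0 := fun n => by
    have := hu (n + 1)
    rwa [show u + ((n + 1 : ℤ) : ℂ) * τ = u + τ + n * τ by push_cast; ring] at this
  have h4 := summable_poleCoeff hτ hu'
  have h5 := (Equiv.subRight (1 : ℤ)).tsum_eq fun n : ℤ => gaussTerm τ n *
      poleCoeff τ n (poleFun (u + τ + n * τ))
  have h6 := (Equiv.subRight (1 : ℤ)).summable_iff.mpr h4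
  have h7 := (Equiv.subRight (1 : ℤ)).tsum_eq fun n : ℤ => gaussTerm τ n *
      (4 * (n : ℂ) ^ 2 - thetaLog τ)
  have h8 := (Equiv.subRight (1 : ℤ)).summable_iff.mpr h1
  simp only [Equiv.subRight_apply, Function.comp_def] at h5 h6 h7 h8
  have hq := expTwoPi_ne_zero τ
  have hz := expTwoPi_ne_zero u
  set t : ℤ → ℂ := fun n => gaussTerm τ n * (expTwoPi τ ^ n)⁻¹ *
    ((2 * n - 1) ^ 2 - thetaLog τ) with ht
  have key : ∀ n : ℤ, gaussTerm τ (n - 1) * poleCoeff τ (n - 1)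
      (poleFun (u + τ + (n - 1 : ℤ) * τ)) + expTwoPi τ * expTwoPi u ^ 2 *
      (gaussTerm τ n * poleCoeff τ n (poleFun (u + n * τ))) -
      gaussTerm τ (n - 1) * (4 * ((n - 1 : ℤ) : ℂ) ^ 2 - thetaLog τ) =
      -(expTwoPi τ * expTwoPi u) * t n := by
    intro n
    have hqn := zpow_ne_zero n hq
    have hx := expTwoPi_ne_zero (u + n * τ)
    have h := poleCoeff_sub (c := thetaLog τ) (n := n) hx (hu n) rfl
    rw [show u + τ + ((n - 1 : ℤ) : ℂ) * τ = u + n * τ by push_cast; ring]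
    rw [← poleFun, expTwoPi_add_int_mul, mul_inv] at h
    simp only [ht, gaussTerm_sub_one, poleCoeff]
    generalize poleFun (u + n * τ) = w at *
    push_cast
    generalize expTwoPi τ ^ n = y at *
    field_simp at h ⊢
    linear_combination (-gaussTerm τ n) * h
  have hts : Summable t := by
    have := (h6.add (h3.mul_left (expTwoPi τ * expTwoPi u ^ 2))).sub h8
    simp only [key] at this
    exact (summable_mul_left_iff (neg_ne_zero.mpr (mul_ne_zero hq hz))).mp this
  have ht0 : ∑' n, t n = 0 := by
    have h9 := (Equiv.subLeft (1 : ℤ)).tsum_eq t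
    have : ∀ n : ℤ, t (1 - n) = -t n := by
      intro n
      have hqn := zpow_ne_zero n hq
      have e1 : gaussTerm τ (1 - n) = gaussTerm τ (n - 1) := by
        rw [← gaussTerm_neg, neg_sub]
      simp only [ht, e1, gaussTerm_sub_one]
      rw [zpow_sub₀ hq, zpow_one]
      push_cast
      field_simp
      ring
    simp only [Equiv.subLeft_apply, this, tsum_neg] at h9
    linear_combination (-1 / 2 : ℂ) * h9
  have h9 := tsum_congr (L := .unconditional ℤ) key
  rw [(h6.add (h3.mul_left _)).tsum_sub h8, h6.tsum_add (h3.mul_left _), tsum_mul_left,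
    tsum_mul_left, ht0, h7, h2, h5] at h9
  rw [lerchPole, lerchPole]
  linear_combination h9

lemma differentiableAt_lerchPole {u τ : ℂ} (hτ : 0 < τ.im)
    (hu : ∀ n : ℤ, 1 - expTwoPi (u + n * τ) ≠ 0) : DifferentiableAt ℂ (lerchPole τ) u :=
  (hasDerivAt_tsum_left hτ (quadBounded_poleCoeff τ) (fun n => Or.inr (hu n))).differentiableAt

lemma analyticAt_lerchPole {u τ : ℂ} (hτ : 0 < τ.im)
    (hu : ∀ n : ℤ, 1 - expTwoPi (u + n * τ) ≠ 0) : AnalyticAt ℂ (lerchPole τ) u :=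
  Complex.analyticAt_iff_eventually_differentiableAt.mpr
    ((eventually_one_sub_ne_zero_left hτ hu).mono fun _ hv => differentiableAt_lerchPole hτ hv)

lemma one_sub_half_ne_zero {τ : ℂ} (hτ : 0 < τ.im) (n : ℤ) :
    1 - expTwoPi (1 / 2 + n * τ) ≠ 0 := by
  rw [expTwoPi_add_int_mul, expTwoPi_half, neg_one_mul, sub_neg_eq_add]
  exact one_add_expTwoPi_zpow_ne_zero hτ n

lemma lerchPole_half {τ : ℂ} (hτ : 0 < τ.im) : lerchPole τ (1 / 2) = 0 := by
  have h1 := lerchPole_neg hτ (one_sub_half_ne_zero hτ)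
  have h2 := lerchPole_add_one τ (-(1 / 2))
  norm_num at h1 h2
  linear_combination (1 / 2 : ℂ) * (h1 + h2)

lemma exists_analyticAt_lerchPole_zero {τ : ℂ} (hτ : 0 < τ.im) :
    ∃ g : ℂ → ℂ, AnalyticAt ℂ g 0 ∧ g 0 = 2 ∧
      ∀ᶠ v in nhdsWithin 0 {0}ᶜ, (1 - expTwoPi v) ^ 3 * lerchPole τ v = g v := by
  set f : ℤ → ℂ → ℂ := fun n => if n = 0 then 0 else poleCoeff τ n with hf_def
  have hf : QuadBounded f := by
    have h := quadBounded_poleCoeff τ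
    refine ⟨fun n => ?_, fun C => ?_⟩
    · by_cases hn : n = 0
      · simp [hf_def, hn]
      · simpa [hf_def, hn] using h.1 n
    · obtain ⟨M, hM⟩ := h.2 C
      refine ⟨M, fun n w hw => ?_⟩
      by_cases hn : n = 0
      · simpa [hf_def, hn] using (norm_nonneg _).trans (hM 0 w hw)
      · simpa [hf_def, hn] using hM n w hw
  have hne₀ : ∀ n : ℤ, n ≠ 0 → 1 - expTwoPi (0 + n * τ) ≠ 0 := fun n hn =>
    one_sub_expTwoPi_ne_zero (by simpa using ⟨hn, hτ.ne'⟩)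
  have hne : ∀ n, f n = 0 ∨ 1 - expTwoPi (0 + n * τ) ≠ 0 := by
    intro n
    by_cases hn : n = 0
    · simp [hf_def, hn]
    · exact Or.inr (hne₀ n hn)
  obtain ⟨C, -, hC⟩ := exists_eventually_norm_inv_one_sub_le 0 hτ
  obtain ⟨b, -, hb⟩ := exists_summable_bound hτ hf hne
  have hev := (tendsto_prodMk_left 0 τ).eventually hb
  set g₁ : ℂ → ℂ := fun v => ∑' n : ℤ, gaussTerm τ n * f n (poleFun (v + n * τ))
  have hg₁ : AnalyticAt ℂ g₁ 0 := Complex.analyticAt_iff_eventually_differentiableAt.mpr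
    (hev.mono fun v hv => (hasDerivAt_tsum_left hτ hf fun n => (hv n).1).differentiableAt)
  have hE : AnalyticAt ℂ expTwoPi 0 := differentiable_expTwoPi.analyticAt 0
  refine ⟨fun v => -thetaLog τ * (1 - expTwoPi v) ^ 2 + expTwoPi v * (1 + expTwoPi v) +
    (1 - expTwoPi v) ^ 3 * g₁ v, by fun_prop, by norm_num [expTwoPi_zero], ?_⟩
  have hz : ∀ᶠ v in nhdsWithin (0 : ℂ) {0}ᶜ, 1 - expTwoPi v ≠ 0 := by
    have hd := (hasDerivAt_expTwoPi 0).eventually_ne (c := 1) (by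
      rw [expTwoPi_zero, mul_one]; exact Complex.two_pi_I_ne_zero)
    exact hd.mono fun v hv => sub_ne_zero.mpr hv.symm
  filter_upwards [hz, ((tendsto_prodMk_left 0 τ).eventually hC).filter_mono nhdsWithin_le_nhds]
    with v hv hv'
  have hu : ∀ n : ℤ, 1 - expTwoPi (v + n * τ) ≠ 0 := by
    intro n
    by_cases hn : n = 0
    · simpa [hn] using hv
    · exact (hv' n (hne₀ n hn)).1
  have hs := summable_poleCoeff hτ hu
  have h1 : lerchPole τ v = poleCoeff τ 0 (poleFun v) + g₁ v := by
    rw [lerchPole, hs.tsum_eq_add_tsum_ite 0]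
    congr 1
    · simp [gaussTerm, expTwoPi_zero]
    · refine tsum_congr fun n => ?_
      by_cases hn : n = 0 <;> simp [hf_def, hn]
  rw [h1, poleCoeff, poleFun]
  push_cast
  field_simp
  ring

/-! ### Elliptic functions with removable singularities -/

/-- `f` extends analytically across the point `u`. -/
def RemovableAt (f : ℂ → ℂ) (u : ℂ) : Prop :=
  ∃ g : ℂ → ℂ, AnalyticAt ℂ g u ∧ ∀ᶠ v in nhdsWithin u {u}ᶜ, f v = g v

lemma limUnder_eq_of_eventually {f g : ℂ → ℂ} {u : ℂ} (hg : ContinuousAt g u)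
    (h : ∀ᶠ v in nhdsWithin u {u}ᶜ, f v = g v) : limUnder (nhdsWithin u {u}ᶜ) f = g u :=
  ((hg.tendsto.mono_left nhdsWithin_le_nhds).congr' (h.mono fun _ hv => hv.symm)).limUnder_eq

lemma RemovableAt.differentiableAt {f : ℂ → ℂ} {u : ℂ} (h : RemovableAt f u) :
    DifferentiableAt ℂ (fun v => limUnder (nhdsWithin v {v}ᶜ) f) u := by
  obtain ⟨g, hg, hfg⟩ := h
  have h0 := limUnder_eq_of_eventually hg.continuousAt hfg
  refine hg.differentiableAt.congr_of_eventuallyEq ?_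
  have h1 : ∀ᶠ v in nhdsWithin u {u}ᶜ, limUnder (nhdsWithin v {v}ᶜ) f = g v := by
    filter_upwards [eventually_nhdsNE_eventually_nhds_iff.mpr hfg,
      hg.eventually_analyticAt.filter_mono nhdsWithin_le_nhds] with v hv hgv
    exact limUnder_eq_of_eventually hgv.continuousAt (hv.filter_mono nhdsWithin_le_nhds)
  rw [eventually_nhdsWithin_iff] at h1
  filter_upwards [h1] with v hv
  rcases eq_or_ne v u with rfl | hvu
  · exact h0
  · exact hv hvu

lemma tendsto_sub_nhdsNE (u p : ℂ) :
    Tendsto (fun v => v - p) (nhdsWithin (u + p) {u + p}ᶜ) (nhdsWithin u {u}ᶜ) := by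
  refine tendsto_nhdsWithin_iff.mpr ⟨?_, ?_⟩
  · have : Tendsto (fun v : ℂ => v - p) (nhds (u + p)) (nhds (u + p - p)) :=
      (continuous_id.sub continuous_const).tendsto _
    rw [add_sub_cancel_right] at this
    exact this.mono_left nhdsWithin_le_nhds
  · filter_upwards [self_mem_nhdsWithin] with v hv
    simpa [sub_eq_iff_eq_add] using hv

lemma RemovableAt.add_period {f : ℂ → ℂ} {u p : ℂ} (hp : Function.Periodic f p)
    (h : RemovableAt f u) : RemovableAt f (u + p) := by
  obtain ⟨g, hg, hfg⟩ := h
  refine ⟨fun v => g (v - p), ?_, ?_⟩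
  · refine AnalyticAt.fun_comp (by rwa [add_sub_cancel_right]) (by fun_prop)
  · filter_upwards [(tendsto_sub_nhdsNE u p).eventually hfg] with v hv
    rw [← hv, hp.sub_eq]

lemma limUnder_periodic {f : ℂ → ℂ} {p : ℂ} (hp : Function.Periodic f p)
    (h : ∀ u, RemovableAt f u) :
    Function.Periodic (fun v => limUnder (nhdsWithin v {v}ᶜ) f) p := by
  intro u
  obtain ⟨g, hg, hfg⟩ := h u
  have h1 := limUnder_eq_of_eventually hg.continuousAt hfg
  have h2 := limUnder_eq_of_eventually (f := f) (g := fun v => g (v - p)) (u := u + p)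
    (ContinuousAt.comp' (by rw [add_sub_cancel_right]; exact hg.continuousAt) (by fun_prop))
    (by
      filter_upwards [(tendsto_sub_nhdsNE u p).eventually hfg] with v hv
      rw [← hv, hp.sub_eq])
  simp only [h1, h2, add_sub_cancel_right]

lemma isBounded_range_of_periodic {f : ℂ → ℂ} {τ : ℂ} (hτ : 0 < τ.im) (hf : Continuous f)
    (h1 : Function.Periodic f 1) (h2 : Function.Periodic f τ) :
    Bornology.IsBounded (Set.range f) := by
  set φ : ℝ × ℝ → ℂ := fun p => p.1 * τ + p.2 with hφ
  have hφc : Continuous φ := by fun_prop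
  have hK : IsCompact ((fun p => f (φ p)) '' (Set.Icc 0 1 ×ˢ Set.Icc 0 1)) :=
    (isCompact_Icc.prod isCompact_Icc).image (hf.comp hφc)
  refine hK.isBounded.subset ?_
  rintro _ ⟨u, rfl⟩
  set a : ℝ := u.im / τ.im with ha
  set b : ℝ := (u - a * τ).re with hb
  have hu : u = a * τ + b := by
    apply Complex.ext
    · simp [hb]
    · simp [ha, hτ.ne']
  refine ⟨(Int.fract a, Int.fract b), ⟨⟨Int.fract_nonneg _, (Int.fract_lt_one _).le⟩,
    ⟨Int.fract_nonneg _, (Int.fract_lt_one _).le⟩⟩, ?_⟩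
  have e : u = φ (Int.fract a, Int.fract b) + (⌊a⌋ : ℂ) * τ + (⌊b⌋ : ℂ) * 1 := by
    have ea : (a : ℂ) = (Int.fract a : ℝ) + (⌊a⌋ : ℂ) := by
      exact_mod_cast congrArg (fun x : ℝ => (x : ℂ)) (Int.fract_add_floor a).symm
    have eb : (b : ℂ) = (Int.fract b : ℝ) + (⌊b⌋ : ℂ) := by
      exact_mod_cast congrArg (fun x : ℝ => (x : ℂ)) (Int.fract_add_floor b).symm
    rw [hφ, hu, ea, eb]
    ring
  conv_rhs => rw [e]
  rw [(h1.int_mul ⌊b⌋) _, (h2.int_mul ⌊a⌋) _]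

lemma exists_forall_eq_of_removable {f : ℂ → ℂ} {τ : ℂ} (hτ : 0 < τ.im)
    (h1 : Function.Periodic f 1) (h2 : Function.Periodic f τ) (h : ∀ u, RemovableAt f u) :
    ∃ c : ℂ, ∀ (u : ℂ) (g : ℂ → ℂ), ContinuousAt g u →
      (∀ᶠ v in nhdsWithin u {u}ᶜ, f v = g v) → g u = c := by
  have hd : Differentiable ℂ fun v => limUnder (nhdsWithin v {v}ᶜ) f :=
    fun u => (h u).differentiableAt
  obtain ⟨c, hc⟩ := hd.exists_const_forall_eq_of_bounded
    (isBounded_range_of_periodic hτ hd.continuous (limUnder_periodic h1 h)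
      (limUnder_periodic h2 h))
  exact ⟨c, fun u g hg hfg => (limUnder_eq_of_eventually hg hfg).symm.trans (hc u)⟩

lemma removableAt_div {f g : ℂ → ℂ} {u : ℂ} (hf : AnalyticAt ℂ f u) (hg : AnalyticAt ℂ g u)
    (hf0 : f u = 0) (hg0 : g u = 0) (hg' : deriv g u ≠ 0) :
    RemovableAt (fun v => f v / g v) u := by
  obtain ⟨p, hp⟩ := hf
  obtain ⟨r, hr⟩ := hg
  refine ⟨fun v => dslope f u v / dslope g u v,
    hp.has_fpower_series_dslope_fslope.analyticAt.fun_div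
      hr.has_fpower_series_dslope_fslope.analyticAt (by rwa [dslope_same]), ?_⟩
  filter_upwards [self_mem_nhdsWithin] with v hv
  have hvu : v - u ≠ 0 := sub_ne_zero.mpr hv
  rw [dslope_of_ne _ hv, dslope_of_ne _ hv, slope_def_field, slope_def_field, hf0, hg0,
    sub_zero, sub_zero, div_div_div_cancel_right₀ hvu]

/-! ### The theta product -/

/-- The theta product `(z;q)_∞ (q/z;q)_∞`. -/
def thetaProd (τ u : ℂ) : ℂ :=
  qPochInf (expTwoPi u) (expTwoPi τ) * qPochInf ((expTwoPi u)⁻¹ * expTwoPi τ) (expTwoPi τ)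

/-- The theta product without the factor `1 - z`. -/
def thetaProdAux (τ u : ℂ) : ℂ :=
  qPochInf (expTwoPi u * expTwoPi τ) (expTwoPi τ) *
    qPochInf ((expTwoPi u)⁻¹ * expTwoPi τ) (expTwoPi τ)

lemma thetaProd_eq_mul {τ : ℂ} (hτ : 0 < τ.im) (u : ℂ) :
    thetaProd τ u = (1 - expTwoPi u) * thetaProdAux τ u := by
  rw [thetaProd, thetaProdAux, qPochInf_eq_mul (expTwoPi u) (norm_expTwoPi_lt_one hτ), mul_assoc]

lemma thetaProd_eq_zero_iff {τ : ℂ} (hτ : 0 < τ.im) {u : ℂ} :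
    thetaProd τ u = 0 ↔ ∃ n : ℤ, 1 - expTwoPi (u + n * τ) = 0 := by
  have hq := norm_expTwoPi_lt_one hτ
  have hq0 := expTwoPi_ne_zero τ
  have hz0 := expTwoPi_ne_zero u
  constructor
  · contrapose!
    intro h
    refine mul_ne_zero (qPochInf_ne_zero hq fun j => ?_) (qPochInf_ne_zero hq fun j => ?_)
    · rw [← zpow_natCast, ← expTwoPi_add_int_mul]
      exact h j
    · intro h0
      apply h (-(j + 1))
      rw [expTwoPi_add_int_mul, zpow_neg, sub_eq_zero, eq_comm, mul_inv_eq_one₀ (zpow_ne_zero _ hq0)]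
      rw [sub_eq_zero, eq_comm, mul_assoc, inv_mul_eq_one₀ hz0] at h0
      rw [h0, zpow_add_one₀ hq0, zpow_natCast, mul_comm]
  · rintro ⟨n, hn⟩
    rw [expTwoPi_add_int_mul] at hn
    rcases le_or_gt 0 n with h | h
    · obtain ⟨j, rfl⟩ := Int.eq_ofNat_of_zero_le h
      refine mul_eq_zero_of_left (tprod_of_exists_eq_zero ⟨j, ?_⟩) _
      simpa using hn
    · obtain ⟨j, rfl⟩ : ∃ j : ℕ, n = -(j + 1) := ⟨(-n - 1).toNat, by lia⟩
      refine mul_eq_zero_of_right _ (tprod_of_exists_eq_zero ⟨j, ?_⟩)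
      rw [zpow_neg, sub_eq_zero, eq_comm, mul_inv_eq_one₀ (zpow_ne_zero _ hq0),
        zpow_add_one₀ hq0, zpow_natCast] at hn
      rw [sub_eq_zero, eq_comm, mul_assoc, inv_mul_eq_one₀ hz0, hn, mul_comm]

lemma thetaProd_add_one (τ u : ℂ) : thetaProd τ (u + 1) = thetaProd τ u := by
  simp only [thetaProd, expTwoPi_add, expTwoPi_one, mul_one]

lemma thetaProd_add_self {τ : ℂ} (hτ : 0 < τ.im) (u : ℂ) :
    thetaProd τ (u + τ) = -(expTwoPi u)⁻¹ * thetaProd τ u := by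
  have hq := norm_expTwoPi_lt_one hτ
  have hq0 := expTwoPi_ne_zero τ
  have hz0 := expTwoPi_ne_zero u
  rw [thetaProd_eq_mul hτ u, thetaProdAux, thetaProd, expTwoPi_add,
    show (expTwoPi u * expTwoPi τ)⁻¹ * expTwoPi τ = (expTwoPi u)⁻¹ by field_simp,
    qPochInf_eq_mul (expTwoPi u)⁻¹ hq]
  field_simp
  ring

lemma differentiable_thetaProdAux {τ : ℂ} (hτ : 0 < τ.im) :
    Differentiable ℂ (thetaProdAux τ) := by
  have h := differentiable_qPochInf (norm_expTwoPi_lt_one hτ)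
  have he := differentiable_expTwoPi
  refine (h.comp (he.mul_const _)).mul (h.comp ((he.inv expTwoPi_ne_zero).mul_const _))

lemma differentiable_thetaProd {τ : ℂ} (hτ : 0 < τ.im) : Differentiable ℂ (thetaProd τ) := by
  rw [funext (thetaProd_eq_mul hτ)]
  exact (differentiable_expTwoPi.const_sub 1).mul (differentiable_thetaProdAux hτ)

lemma thetaProdAux_zero (τ : ℂ) :
    thetaProdAux τ 0 = qPochInf (expTwoPi τ) (expTwoPi τ) ^ 2 := by
  simp [thetaProdAux, expTwoPi_zero, sq]

lemma thetaProd_half (τ : ℂ) : thetaProd τ (1 / 2) =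
    qPochInf (-1) (expTwoPi τ) * qPochInf (-expTwoPi τ) (expTwoPi τ) := by
  simp only [thetaProd, expTwoPi_half, inv_neg, inv_one, neg_one_mul]

lemma thetaProd_half_ne_zero {τ : ℂ} (hτ : 0 < τ.im) : thetaProd τ (1 / 2) ≠ 0 := fun h => by
  obtain ⟨n, hn⟩ := (thetaProd_eq_zero_iff hτ).mp h
  exact one_sub_half_ne_zero hτ n hn

/-! ### The theta quotient is constant -/

/-- The denominator `z θ(u + 1/2)`. -/
def thetaDenom (τ u : ℂ) : ℂ := expTwoPi u * thetaProd τ (u + 1 / 2)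

/-- The elliptic function `S(u) θ(u)³ / (z θ(u + 1/2))`. -/
def thetaQuot (τ u : ℂ) : ℂ := lerchPole τ u * thetaProd τ u ^ 3 / thetaDenom τ u

lemma differentiable_thetaDenom {τ : ℂ} (hτ : 0 < τ.im) : Differentiable ℂ (thetaDenom τ) :=
  differentiable_expTwoPi.mul ((differentiable_thetaProd hτ).comp (differentiable_id.add_const _))

lemma thetaQuot_periodic_one (τ : ℂ) : Function.Periodic (thetaQuot τ) 1 := fun u => by
  rw [thetaQuot, thetaQuot, thetaDenom, thetaDenom, lerchPole_add_one, thetaProd_add_one,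
    add_right_comm, thetaProd_add_one, expTwoPi_add, expTwoPi_one, mul_one]

lemma thetaQuot_periodic_self {τ : ℂ} (hτ : 0 < τ.im) : Function.Periodic (thetaQuot τ) τ := by
  intro u
  have hq0 := expTwoPi_ne_zero τ
  have hz0 := expTwoPi_ne_zero u
  by_cases h : thetaProd τ u = 0
  · simp [thetaQuot, thetaProd_add_self hτ, h]
  · have hu : ∀ n : ℤ, 1 - expTwoPi (u + n * τ) ≠ 0 := fun n hn =>
      h ((thetaProd_eq_zero_iff hτ).mpr ⟨n, hn⟩)
    rw [thetaQuot, thetaQuot, thetaDenom, thetaDenom, lerchPole_add_self hτ hu,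
      thetaProd_add_self hτ, add_right_comm, thetaProd_add_self hτ, expTwoPi_add, expTwoPi_add,
      expTwoPi_half]
    by_cases h' : thetaProd τ (u + 1 / 2) = 0
    · simp only [h', mul_zero, div_zero]
    · field_simp

lemma eventually_thetaQuot_eq_zero {τ : ℂ} (hτ : 0 < τ.im) :
    ∃ g : ℂ → ℂ, AnalyticAt ℂ g 0 ∧
      g 0 = 2 * qPochInf (expTwoPi τ) (expTwoPi τ) ^ 6 / thetaProd τ (1 / 2) ∧
      ∀ᶠ v in nhdsWithin 0 {0}ᶜ, thetaQuot τ v = g v := by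
  obtain ⟨g, hg, hg0, h⟩ := exists_analyticAt_lerchPole_zero hτ
  refine ⟨fun v => g v * thetaProdAux τ v ^ 3 / thetaDenom τ v, ?_, ?_, ?_⟩
  · refine (hg.mul (((differentiable_thetaProdAux hτ).analyticAt 0).pow 3)).fun_div
      ((differentiable_thetaDenom hτ).analyticAt 0) ?_
    simpa [thetaDenom, expTwoPi_zero] using thetaProd_half_ne_zero hτ
  · simp only [hg0, thetaProdAux_zero, thetaDenom, expTwoPi_zero, one_mul, zero_add]
    ring
  · filter_upwards [h] with v hv
    rw [thetaQuot, ← hv, thetaProd_eq_mul hτ]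
    ring

lemma deriv_thetaDenom_half_ne_zero {τ : ℂ} (hτ : 0 < τ.im) :
    deriv (thetaDenom τ) (1 / 2) ≠ 0 := by
  have hq := norm_expTwoPi_lt_one hτ
  have h1 : HasDerivAt (thetaDenom τ) _ (1 / 2) :=
    (hasDerivAt_expTwoPi (1 / 2)).mul
      ((differentiable_thetaProd hτ).differentiableAt.hasDerivAt.comp_add_const (1 / 2) (1 / 2))
  have h2 : HasDerivAt (fun v => (1 - expTwoPi v) * thetaProdAux τ v) _ 1 :=
    ((hasDerivAt_expTwoPi 1).const_sub 1).mul
      (differentiable_thetaProdAux hτ).differentiableAt.hasDerivAt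
  rw [← funext (thetaProd_eq_mul hτ)] at h2
  have h3 : thetaProdAux τ 1 = qPochInf (expTwoPi τ) (expTwoPi τ) ^ 2 := by
    simp [thetaProdAux, expTwoPi_one, sq]
  rw [h1.deriv, add_halves, h2.deriv, thetaProd_eq_mul hτ, h3, expTwoPi_one, expTwoPi_half]
  have := pow_ne_zero 2 (qPochInf_ne_zero_of_norm_lt hq hq)
  have := Complex.two_pi_I_ne_zero
  simp_all

lemma removableAt_thetaQuot_half {τ : ℂ} (hτ : 0 < τ.im) : RemovableAt (thetaQuot τ) (1 / 2) := by
  refine removableAt_div ((analyticAt_lerchPole hτ (one_sub_half_ne_zero hτ)).mul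
    (((differentiable_thetaProd hτ).analyticAt _).pow 3))
    ((differentiable_thetaDenom hτ).analyticAt _) ?_ ?_ (deriv_thetaDenom_half_ne_zero hτ)
  · rw [lerchPole_half hτ, zero_mul]
  · rw [thetaDenom, add_halves, thetaProd_eq_mul hτ, expTwoPi_one]
    simp

lemma exists_eq_add_of_thetaProd_eq_zero {τ u : ℂ} (hτ : 0 < τ.im) (h : thetaProd τ u = 0) :
    ∃ m n : ℤ, u = m * 1 + n * τ := by
  obtain ⟨n, hn⟩ := (thetaProd_eq_zero_iff hτ).mp h
  obtain ⟨m, hm⟩ := expTwoPi_eq_one_iff.mp (sub_eq_zero.mp hn).symm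
  exact ⟨m, -n, by push_cast; linear_combination hm⟩

lemma removableAt_thetaQuot {τ : ℂ} (hτ : 0 < τ.im) (u : ℂ) : RemovableAt (thetaQuot τ) u := by
  have hp : ∀ m n : ℤ, Function.Periodic (thetaQuot τ) (m * 1 + n * τ) := fun m n =>
    ((thetaQuot_periodic_one τ).int_mul m).add_period ((thetaQuot_periodic_self hτ).int_mul n)
  by_cases h : thetaProd τ u = 0
  · obtain ⟨m, n, rfl⟩ := exists_eq_add_of_thetaProd_eq_zero hτ h
    obtain ⟨g, hg, -, h⟩ := eventually_thetaQuot_eq_zero hτ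
    simpa using RemovableAt.add_period (hp m n) ⟨g, hg, h⟩
  · by_cases h' : thetaProd τ (u + 1 / 2) = 0
    · obtain ⟨m, n, hu⟩ := exists_eq_add_of_thetaProd_eq_zero hτ h'
      have e : u = 1 / 2 + ((m - 1 : ℤ) * 1 + n * τ) := by
        push_cast; linear_combination hu
      rw [e]
      exact (removableAt_thetaQuot_half hτ).add_period (hp _ n)
    · refine ⟨thetaQuot τ, ?_, Eventually.of_forall fun _ => rfl⟩
      have hu : ∀ n : ℤ, 1 - expTwoPi (u + n * τ) ≠ 0 := fun n hn =>
        h ((thetaProd_eq_zero_iff hτ).mpr ⟨n, hn⟩)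
      exact ((analyticAt_lerchPole hτ hu).mul
        (((differentiable_thetaProd hτ).analyticAt u).pow 3)).fun_div
        ((differentiable_thetaDenom hτ).analyticAt u) (mul_ne_zero (expTwoPi_ne_zero u) h')

lemma lerchPole_mul_thetaProd {τ u : ℂ} (hτ : 0 < τ.im)
    (hu : ∀ n : ℤ, 1 - expTwoPi (u + n * τ) ≠ 0) :
    lerchPole τ u * thetaProd τ u ^ 3 =
      2 * qPochInf (expTwoPi τ) (expTwoPi τ) ^ 6 / thetaProd τ (1 / 2) *
        (expTwoPi u * thetaProd τ (u + 1 / 2)) := by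
  obtain ⟨c, hc⟩ := exists_forall_eq_of_removable hτ (thetaQuot_periodic_one τ)
    (thetaQuot_periodic_self hτ) (removableAt_thetaQuot hτ)
  obtain ⟨g, hg, hg0, hg1⟩ := eventually_thetaQuot_eq_zero hτ
  rw [← hg0, hc 0 g hg.continuousAt hg1]
  have hS := ((analyticAt_lerchPole hτ hu).mul
    (((differentiable_thetaProd hτ).analyticAt u).pow 3))
  have hT := (differentiable_thetaDenom hτ).analyticAt u
  -- both sides are continuous and agree off the zeros of the denominator
  have key : ∀ᶠ v in nhdsWithin u {u}ᶜ,
      lerchPole τ v * thetaProd τ v ^ 3 = c * thetaDenom τ v := by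
    have hne : ∀ᶠ v in nhdsWithin u {u}ᶜ, thetaDenom τ v ≠ 0 := by
      refine hT.eventually_eq_zero_or_eventually_ne_zero.resolve_left fun h0 => ?_
      have h1 := (analyticOnNhd_univ_iff_differentiable.mpr
        (differentiable_thetaDenom hτ)).eq_of_eventuallyEq
        (g := fun _ => 0) (fun _ _ => analyticAt_const) h0
      have h2 : thetaDenom τ 0 = 0 := congrFun h1 0
      rw [thetaDenom, expTwoPi_zero, one_mul, zero_add] at h2
      exact thetaProd_half_ne_zero hτ h2
    filter_upwards [hne, (eventually_one_sub_ne_zero_left hτ hu).filter_mono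
      nhdsWithin_le_nhds] with v hv hv'
    have h1 : ContinuousAt (thetaQuot τ) v := (((analyticAt_lerchPole hτ hv').mul
      (((differentiable_thetaProd hτ).analyticAt v).pow 3)).fun_div
        ((differentiable_thetaDenom hτ).analyticAt v) hv).continuousAt
    rw [← hc v _ h1 (Eventually.of_forall fun _ => rfl), thetaQuot, div_mul_cancel₀ _ hv]
  exact tendsto_nhds_unique
    ((hS.continuousAt.tendsto.mono_left nhdsWithin_le_nhds).congr' key)
    ((hT.continuousAt.tendsto.mono_left nhdsWithin_le_nhds).const_mul c)

/-! ### The crank generating function -/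

lemma crankStar_eq {τ u : ℂ} (hτ : 0 < τ.im) (hu : ∀ n : ℤ, 1 - expTwoPi (u + n * τ) ≠ 0) :
    crankStar (expTwoPi u) (expTwoPi τ) =
      qPochInf (expTwoPi τ) (expTwoPi τ) / thetaProd τ u := by
  have hq := norm_expTwoPi_lt_one hτ
  have hA : thetaProdAux τ u ≠ 0 := by
    have : thetaProd τ u ≠ 0 := fun h => by
      obtain ⟨n, hn⟩ := (thetaProd_eq_zero_iff hτ).mp h
      exact hu n hn
    rw [thetaProd_eq_mul hτ] at this
    exact right_ne_zero_of_mul this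
  have h1 := (multipliable_qPoch (expTwoPi τ) hq).hasProd
  have h2 := (multipliable_qPoch (expTwoPi u * expTwoPi τ) hq).hasProd.mul
    (multipliable_qPoch ((expTwoPi u)⁻¹ * expTwoPi τ) hq).hasProd
  have h3 := h1.div₀ h2 hA
  rw [thetaProd_eq_mul hτ, crankStar, mul_comm, ← div_eq_mul_inv, mul_comm (1 - expTwoPi u),
    ← div_div]
  congr 1
  rw [thetaProdAux]
  refine Eq.trans (tprod_congr fun n => ?_) h3.tprod_eq
  rw [pow_succ', mul_assoc, mul_assoc]

lemma crankStar_cube_eq {τ u : ℂ} (hτ : 0 < τ.im)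
    (hu : ∀ n : ℤ, 1 - expTwoPi (u + n * τ) ≠ 0) :
    expTwoPi u * (qPochInf (expTwoPi τ) (expTwoPi τ) ^ 2 /
        qPochInf (-expTwoPi τ) (expTwoPi τ)) * crankStar (expTwoPi u) (expTwoPi τ) ^ 3 *
      qPochInf (-expTwoPi u) (expTwoPi τ) *
      qPochInf (-(expTwoPi u)⁻¹ * expTwoPi τ) (expTwoPi τ) =
    lerchConst τ / 2 * lerchPole τ u := by
  have hq := norm_expTwoPi_lt_one hτ
  have h := lerchPole_mul_thetaProd hτ hu
  have hθ : thetaProd τ u ≠ 0 := fun h => by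
    obtain ⟨n, hn⟩ := (thetaProd_eq_zero_iff hτ).mp h
    exact hu n hn
  have h1 : qPochInf (-1) (expTwoPi τ) = 2 * qPochInf (-expTwoPi τ) (expTwoPi τ) := by
    rw [qPochInf_eq_mul (-1) hq]; norm_num
  have h2 : thetaProd τ (u + 1 / 2) = qPochInf (-expTwoPi u) (expTwoPi τ) *
      qPochInf (-(expTwoPi u)⁻¹ * expTwoPi τ) (expTwoPi τ) := by
    simp only [thetaProd, expTwoPi_add, expTwoPi_half, mul_neg, mul_one, inv_neg, neg_mul]
  have h3 := qPochInf_ne_zero_of_norm_lt hq hq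
  have h4 : qPochInf (-expTwoPi τ) (expTwoPi τ) ≠ 0 :=
    qPochInf_ne_zero_of_norm_lt (by rwa [norm_neg]) hq
  rw [mul_assoc _ (qPochInf (-expTwoPi u) _), ← h2, crankStar_eq hτ hu, lerchConst, h1]
  rw [thetaProd_half, h1] at h
  have h5 := eq_div_of_mul_eq (pow_ne_zero 3 hθ) h
  rw [h5]
  field_simp

/-- The overpartition Rank–Crank type PDE. -/
theorem overpartition_pde (τ u : ℂ) (hτ : 0 < τ.im)
    (hu : ∀ m n : ℤ, u ≠ (m : ℂ) * τ + (n : ℂ)) :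
    Complex.exp (2 * π * I * u) *
        (qPochInf (Complex.exp (2 * π * I * τ)) (Complex.exp (2 * π * I * τ)) ^ 2 /
          qPochInf (-Complex.exp (2 * π * I * τ)) (Complex.exp (2 * π * I * τ))) *
        crankStar (Complex.exp (2 * π * I * u)) (Complex.exp (2 * π * I * τ)) ^ 3 *
        qPochInf (-Complex.exp (2 * π * I * u)) (Complex.exp (2 * π * I * τ)) *
        qPochInf (-(Complex.exp (2 * π * I * u))⁻¹ * Complex.exp (2 * π * I * τ))
          (Complex.exp (2 * π * I * τ))
    = 2 * (1 + Complex.exp (2 * π * I * u)) * ((2 * π * I)⁻¹ *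
          deriv (fun t : ℂ =>
            nStar10 (Complex.exp (2 * π * I * u)) (Complex.exp (2 * π * I * t))) τ)
      + (Complex.exp (2 * π * I * u) / 2) *
          nStar10 (Complex.exp (2 * π * I * u)) (Complex.exp (2 * π * I * τ))
      + Complex.exp (2 * π * I * u) * ((2 * π * I)⁻¹ *
          deriv (fun w : ℂ =>
            nStar10 (Complex.exp (2 * π * I * w)) (Complex.exp (2 * π * I * τ))) u)
      + (1/2) * (1 + Complex.exp (2 * π * I * u)) * ((2 * π * I)⁻¹)^2 *
          iteratedDeriv 2 (fun w : ℂ =>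
            nStar10 (Complex.exp (2 * π * I * w)) (Complex.exp (2 * π * I * τ))) u := by
  have h : ∀ n : ℤ, 1 - expTwoPi (u + n * τ) ≠ 0 := fun n hn => by
    obtain ⟨m, hm⟩ := expTwoPi_eq_one_iff.mp (sub_eq_zero.mp hn).symm
    exact hu (-n) m (by push_cast; linear_combination hm)
  exact (crankStar_cube_eq hτ h).trans (operator_nStar10 hτ h).symm

end
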